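/- (Strong-type characterization by global testing.) Let 1 < p < q < ∞, let τ = (τ_Q)_{Q∈𝒬} be nonnegative constants, and let σ, ω be weights on ℝ^d. Let 𝔑 = sup{ ‖T_τ(fσ)‖_{L^q(ω)} : f ≥ 0, ‖f‖_{L^p(σ)} ≤ 1 }. Then there are constants c, C > 0 depending only on p, q, d such that c·(⟦σ,ω⟧^Glo_{τ,p,q} + ⟦ω,σ⟧^Glo_{τ,q',p'}) ≤ 𝔑 ≤ C·(⟦σ,ω⟧^Glo_{τ,p,q} + ⟦ω,σ⟧^Glo_{τ,q',p'}), all quantities understood in [0,∞], where ⟦ω,σ⟧^Glo_{τ,q',p'} is the dual global testing constant with the roles of (σ,p,q) and (ω,q',p') interchanged. -/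

import Mathlib

open MeasureTheory ENNReal

noncomputable section

/-- Index set for dyadic cubes of `ℝ^d`: a scale `k : ℤ` and a position `n ∈ ℤ^d`. -/
abbrev DIdx (d : ℕ) : Type := ℤ × (Fin d → ℤ)

/-- The dyadic cube `∏_j [2^k n_j, 2^k (n_j + 1))` of `ℝ^d`. -/
def dcube {d : ℕ} (i : DIdx d) : Set (Fin d → ℝ) :=
  {x | ∀ j, x j ∈ Set.Ico ((2 : ℝ) ^ i.1 * (i.2 j : ℝ)) ((2 : ℝ) ^ i.1 * ((i.2 j : ℝ) + 1))}

/-- The dyadic parent of a dyadic cube: the minimal dyadic cube strictly containing it. -/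
def dparent {d : ℕ} (i : DIdx d) : DIdx d :=
  (i.1 + 1, fun j => Int.fdiv (i.2 j) 2)

/-- The measure `ω dx` on `ℝ^d` associated with a weight `ω`. -/
def wMeasure {d : ℕ} (ω : (Fin d → ℝ) → ℝ≥0∞) : Measure (Fin d → ℝ) :=
  volume.withDensity ω

/-- The average of a nonnegative function `f` over the dyadic cube indexed by `i`,
with respect to the measure `μ`. -/
def cavg {d : ℕ} (μ : Measure (Fin d → ℝ)) (i : DIdx d) (f : (Fin d → ℝ) → ℝ≥0∞) : ℝ≥0∞ :=
  (∫⁻ x in dcube i, f x ∂μ) / μ (dcube i)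

/-- Lebesgue average of a nonnegative function over a dyadic cube. -/
def lavg {d : ℕ} (i : DIdx d) (f : (Fin d → ℝ) → ℝ≥0∞) : ℝ≥0∞ :=
  cavg volume i f

/-- The `L^p` norm (real exponent `p`) of a nonnegative function with respect to `μ`. -/
def lpn {d : ℕ} (p : ℝ) (μ : Measure (Fin d → ℝ)) (f : (Fin d → ℝ) → ℝ≥0∞) : ℝ≥0∞ :=
  (∫⁻ x, f x ^ p ∂μ) ^ (1 / p)

/-- The positive dyadic operator `T_τ f = ∑_Q τ_Q (E_Q f) 1_Q`. -/
def Tdy {d : ℕ} (τ : DIdx d → ℝ≥0∞) (f : (Fin d → ℝ) → ℝ≥0∞) (x : Fin d → ℝ) : ℝ≥0∞ :=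
  ∑' i : DIdx d, (dcube i).indicator (fun _ => τ i * lavg i f) x

/-- The local part `T^in_{τ,R} f = ∑_{Q ⊆ R} τ_Q (E_Q f) 1_Q`. -/
def TdyIn {d : ℕ} (τ : DIdx d → ℝ≥0∞) (R : DIdx d) (f : (Fin d → ℝ) → ℝ≥0∞)
    (x : Fin d → ℝ) : ℝ≥0∞ :=
  ∑' i : {i : DIdx d // dcube i ⊆ dcube R},
    (dcube i.1).indicator (fun _ => τ i.1 * lavg i.1 f) x

/-- The global part `T^out_{τ,R} f = ∑_{Q ⊇ R} τ_Q (E_Q f) 1_Q`. -/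
def TdyOut {d : ℕ} (τ : DIdx d → ℝ≥0∞) (R : DIdx d) (f : (Fin d → ℝ) → ℝ≥0∞)
    (x : Fin d → ℝ) : ℝ≥0∞ :=
  ∑' i : {i : DIdx d // dcube R ⊆ dcube i},
    (dcube i.1).indicator (fun _ => τ i.1 * lavg i.1 f) x

/-- The local testing constant `⟦σ,ω⟧^Loc_{τ,p,q}
= sup_{R : ω(R)>0} ω(R)^{-1/q'} ‖T^in_{τ,R}(1_R ω)‖_{L^{p'}(σ)}`. -/
def locTest {d : ℕ} (p q : ℝ) (τ : DIdx d → ℝ≥0∞) (σ ω : (Fin d → ℝ) → ℝ≥0∞) : ℝ≥0∞ :=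
  ⨆ (R : DIdx d) (_ : wMeasure ω (dcube R) ≠ 0),
    wMeasure ω (dcube R) ^ (-(1 / (q / (q - 1)))) *
      lpn (p / (p - 1)) (wMeasure σ) (TdyIn τ R ((dcube R).indicator ω))

/-- The global testing constant `⟦σ,ω⟧^Glo_{τ,p,q}
= sup_{R : ω(R)>0} ω(R)^{-1/q'} ‖T^out_{τ,R}(1_R ω)‖_{L^{p'}(σ)}`. -/
def gloTest {d : ℕ} (p q : ℝ) (τ : DIdx d → ℝ≥0∞) (σ ω : (Fin d → ℝ) → ℝ≥0∞) : ℝ≥0∞ :=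
  ⨆ (R : DIdx d) (_ : wMeasure ω (dcube R) ≠ 0),
    wMeasure ω (dcube R) ^ (-(1 / (q / (q - 1)))) *
      lpn (p / (p - 1)) (wMeasure σ) (TdyOut τ R ((dcube R).indicator ω))

/-- The least weak-type `L^p(σ) → L^{q,∞}(ω)` constant of `f ↦ T_τ(fσ)`. -/
def weakConst {d : ℕ} (p q : ℝ) (τ : DIdx d → ℝ≥0∞) (σ ω : (Fin d → ℝ) → ℝ≥0∞) : ℝ≥0∞ :=
  sInf {N : ℝ≥0∞ | ∀ f : (Fin d → ℝ) → ℝ≥0∞, Measurable f → lpn p (wMeasure σ) f ≠ ⊤ →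
    ∀ lam : ℝ≥0∞, 0 < lam →
      wMeasure ω {x | lam < Tdy τ (fun y => f y * σ y) x} ≤
        (N * lpn p (wMeasure σ) f / lam) ^ q}


/-- The dual global testing constant `⟦ω,σ⟧^Glo_{τ,q',p'}
= sup_{R : σ(R)>0} σ(R)^{-1/p} ‖T^out_{τ,R}(1_R σ)‖_{L^{q}(ω)}`. -/
def gloTestDual {d : ℕ} (p q : ℝ) (τ : DIdx d → ℝ≥0∞) (σ ω : (Fin d → ℝ) → ℝ≥0∞) : ℝ≥0∞ :=
  ⨆ (R : DIdx d) (_ : wMeasure σ (dcube R) ≠ 0),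
    wMeasure σ (dcube R) ^ (-(1 / p)) *
      lpn q (wMeasure ω) (TdyOut τ R ((dcube R).indicator σ))

/-- The `L^p(σ) → L^q(ω)` norm of `f ↦ T_τ(fσ)` over nonnegative `f`. -/
def strongConst {d : ℕ} (p q : ℝ) (τ : DIdx d → ℝ≥0∞) (σ ω : (Fin d → ℝ) → ℝ≥0∞) : ℝ≥0∞ :=
  ⨆ (f : (Fin d → ℝ) → ℝ≥0∞) (_ : Measurable f) (_ : lpn p (wMeasure σ) f ≤ 1),
    lpn q (wMeasure ω) (Tdy τ fun y => f y * σ y)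

theorem two_rpow_ne_zero (t : ℝ) : (2 : ℝ≥0∞) ^ t ≠ 0 :=
  (ENNReal.rpow_pos (by norm_num) (by norm_num)).ne'

theorem two_rpow_ne_top (t : ℝ) : (2 : ℝ≥0∞) ^ t ≠ ⊤ :=
  ENNReal.rpow_ne_top_of_ne_zero (by norm_num) (by norm_num)

theorem two_rpow_add (s t : ℝ) : (2 : ℝ≥0∞) ^ (s + t) = 2 ^ s * 2 ^ t :=
  ENNReal.rpow_add _ _ (by norm_num) (by norm_num)

/-- A geometric sum with ratio `2 ^ s` is dominated by its largest term. -/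
theorem exists_sum_two_rpow_le {s : ℝ} (hs : 0 < s) : ∃ C : ℝ≥0∞, C ≠ ⊤ ∧
    ∀ {ι : Type} (t : Finset ι) (n : ι → ℤ) (y : ℝ≥0∞), Set.InjOn n t →
      (∀ i ∈ t, (2 : ℝ≥0∞) ^ (n i : ℝ) ≤ y) →
      ∑ i ∈ t, (2 : ℝ≥0∞) ^ ((n i : ℝ) * s) ≤ C * y ^ s := by
  have hr : (2 : ℝ≥0∞) ^ (-s) < 1 :=
    ENNReal.rpow_lt_one_of_one_lt_of_neg (by norm_num) (by linarith)
  refine ⟨(1 - (2 : ℝ≥0∞) ^ (-s))⁻¹, ?_, ?_⟩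
  · rw [ENNReal.inv_ne_top]
    exact (tsub_pos_of_lt hr).ne'
  intro ι t n y hn hy
  classical
  rcases t.eq_empty_or_nonempty with rfl | ht
  · simp
  obtain ⟨i₀, hi₀, hmax⟩ := t.exists_max_image n ht
  set k : ι → ℕ := fun i => (n i₀ - n i).toNat with hk
  have hki : ∀ i ∈ t, (n i : ℝ) = n i₀ - k i := by
    intro i hi
    have : (k i : ℤ) = n i₀ - n i := Int.toNat_of_nonneg (by linarith [hmax i hi])
    have h2 : ((k i : ℤ) : ℝ) = n i₀ - n i := by rw [this]; push_cast; ring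
    push_cast at h2
    linarith
  have hkinj : Set.InjOn k t := by
    intro i hi j hj hij
    apply hn hi hj
    have h1 := hki i hi
    have h2 := hki j hj
    rw [hij, ← h2] at h1
    exact_mod_cast h1
  calc ∑ i ∈ t, (2 : ℝ≥0∞) ^ ((n i : ℝ) * s)
      = ∑ i ∈ t, (2 : ℝ≥0∞) ^ ((n i₀ : ℝ) * s) * ((2 : ℝ≥0∞) ^ (-s)) ^ (k i) := by
        refine Finset.sum_congr rfl fun i hi => ?_
        rw [hki i hi, ← ENNReal.rpow_natCast, ← ENNReal.rpow_mul, ← two_rpow_add]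
        congr 1
        ring
    _ = (2 : ℝ≥0∞) ^ ((n i₀ : ℝ) * s) * ∑ m ∈ t.image k, ((2 : ℝ≥0∞) ^ (-s)) ^ m := by
        rw [Finset.sum_image hkinj, Finset.mul_sum]
    _ ≤ y ^ s * ∑' m : ℕ, ((2 : ℝ≥0∞) ^ (-s)) ^ m := by
        gcongr
        · rw [ENNReal.rpow_mul]
          exact ENNReal.rpow_le_rpow (hy i₀ hi₀) hs.le
        · exact ENNReal.sum_le_tsum _
    _ = _ := by rw [ENNReal.tsum_geometric, mul_comm]

theorem exists_two_rpow_level {v : ℝ≥0∞} (h0 : v ≠ 0) (ht : v ≠ ⊤) :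
    ∃ n : ℤ, (2 : ℝ≥0∞) ^ (n : ℝ) < v ∧ v ≤ (2 : ℝ≥0∞) ^ (n + 1 : ℝ) := by
  obtain ⟨n, h1, h2⟩ := ENNReal.exists_mem_Ioc_zpow h0 ht (y := 2) (by norm_num) (by norm_num)
  refine ⟨n, by rwa [ENNReal.rpow_intCast], ?_⟩
  have : ((n : ℝ) + 1) = ((n + 1 : ℤ) : ℝ) := by push_cast; rfl
  rwa [this, ENNReal.rpow_intCast]

/-- `top Q` is the largest ancestor of `Q` in `𝒟` among those maximizing the level `ℓ`
over all ancestors of `Q` in `𝒟`. -/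
structure IsStoppingTop {X : Type} (𝒟 : Finset (Set X)) (ℓ : Set X → ℤ)
    (top : Set X → Set X) : Prop where
  mem : ∀ Q ∈ 𝒟, top Q ∈ 𝒟
  subset : ∀ Q ∈ 𝒟, Q ⊆ top Q
  level_le : ∀ Q ∈ 𝒟, ℓ Q ≤ ℓ (top Q)
  top_eq_of_subset : ∀ Q ∈ 𝒟, ∀ P ∈ 𝒟, Q ⊆ P → P ⊆ top Q → top P = top Q
  top_eq_of_level_eq : ∀ Q ∈ 𝒟, ∀ P ∈ 𝒟, ℓ (top Q) = ℓ (top P) →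
    (top Q ∩ top P).Nonempty → top Q = top P

theorem IsStoppingTop.top_top {X : Type} {𝒟 : Finset (Set X)} {ℓ : Set X → ℤ}
    {top : Set X → Set X}
    (h : IsStoppingTop 𝒟 ℓ top) {Q : Set X} (hQ : Q ∈ 𝒟) : top (top Q) = top Q :=
  h.top_eq_of_subset Q hQ _ (h.mem Q hQ) (h.subset Q hQ) subset_rfl

theorem IsStoppingTop.injOn_level {X : Type} {𝒟 : Finset (Set X)} {ℓ : Set X → ℤ}
    {top : Set X → Set X} (h : IsStoppingTop 𝒟 ℓ top) {Pr : Finset (Set X)}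
    (hPr : ∀ S, S ∈ Pr ↔ S ∈ 𝒟 ∧ top S = S) (x : X) :
    Set.InjOn ℓ {S | S ∈ Pr ∧ x ∈ S} := by
  intro M hM N hN e
  obtain ⟨hM1, hM2⟩ := (hPr M).1 hM.1
  obtain ⟨hN1, hN2⟩ := (hPr N).1 hN.1
  have := h.top_eq_of_level_eq M hM1 N hN1 (by rw [hM2, hN2, e])
    (by rw [hM2, hN2]; exact ⟨x, hM.2, hN.2⟩)
  rwa [hM2, hN2] at this

theorem exists_isStoppingTop {X : Type} (𝒟 : Finset (Set X)) (hne : ∀ Q ∈ 𝒟, Q.Nonempty)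
    (hlam : ∀ P ∈ 𝒟, ∀ Q ∈ 𝒟, (P ∩ Q).Nonempty → P ⊆ Q ∨ Q ⊆ P) (ℓ : Set X → ℤ) :
    ∃ top : Set X → Set X, IsStoppingTop 𝒟 ℓ top := by
  classical
  have key : ∀ Q ∈ 𝒟, ∃ T, T ∈ 𝒟 ∧ Q ⊆ T ∧ (∀ P ∈ 𝒟, Q ⊆ P → ℓ P ≤ ℓ T) ∧
      (∀ P ∈ 𝒟, Q ⊆ P → ℓ P = ℓ T → P ⊆ T) := by
    intro Q hQ
    obtain ⟨T₁, hT₁, hmax⟩ := (𝒟.filter (Q ⊆ ·)).exists_max_image ℓ ⟨Q, by simp [hQ]⟩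
    rw [Finset.mem_filter] at hT₁
    obtain ⟨T, hT⟩ := (𝒟.filter fun P => Q ⊆ P ∧ ℓ P = ℓ T₁).exists_maximal
      ⟨T₁, by simp [hT₁]⟩
    have hTm := hT.prop
    rw [Finset.mem_filter] at hTm
    refine ⟨T, hTm.1, hTm.2.1, fun P hP hQP => ?_, fun P hP hQP hPT => ?_⟩
    · rw [hTm.2.2]
      exact hmax P (by simp [hP, hQP])
    · obtain ⟨x, hx⟩ := hne Q hQ
      rcases hlam P hP T hTm.1 ⟨x, hQP hx, hTm.2.1 hx⟩ with h | h
      · exact h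
      · exact hT.le_of_ge (by simp [hP, hQP, hPT, hTm.2.2]) h
  choose! top h1 h2 h3 h4 using key
  refine ⟨top, h1, h2, fun Q hQ => h3 Q hQ Q hQ subset_rfl, ?_, ?_⟩
  · intro Q hQ P hP hQP hPT
    have e : ℓ (top P) = ℓ (top Q) :=
      le_antisymm (h3 Q hQ _ (h1 P hP) (hQP.trans (h2 P hP))) (h3 P hP _ (h1 Q hQ) hPT)
    exact (h4 Q hQ _ (h1 P hP) (hQP.trans (h2 P hP)) e).antisymm
      (h4 P hP _ (h1 Q hQ) hPT e.symm)
  · intro Q hQ P hP e hint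
    rcases hlam _ (h1 Q hQ) _ (h1 P hP) hint with h | h
    · exact h.antisymm (h4 Q hQ _ (h1 P hP) ((h2 Q hQ).trans h) e.symm)
    · exact (h4 P hP _ (h1 Q hQ) ((h2 P hP).trans h) e).antisymm h

/-- Carleson-type packing of sets whose `f`-averages exceed a level, disjoint at each level. -/
theorem exists_packing_le {p : ℝ} (hp : 1 < p) : ∃ C : ℝ≥0∞, C ≠ ⊤ ∧
    ∀ {X : Type} [MeasurableSpace X] (μ : Measure X) (𝒮 : Finset (Set X)) (ℓ : Set X → ℤ)
      (f : X → ℝ≥0∞), Measurable f → (∀ S ∈ 𝒮, MeasurableSet S) → (∀ S ∈ 𝒮, μ S ≠ ⊤) →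
      (∀ x, Set.InjOn ℓ {S | S ∈ 𝒮 ∧ x ∈ S}) →
      (∀ S ∈ 𝒮, (2 : ℝ≥0∞) ^ (ℓ S : ℝ) * μ S ≤ ∫⁻ x in S, f x ∂μ) →
      ∑ S ∈ 𝒮, (2 : ℝ≥0∞) ^ (ℓ S * p) * μ S ≤ C * ∫⁻ x, f x ^ p ∂μ := by
  obtain ⟨C, hC, hgeo⟩ := exists_sum_two_rpow_le (s := p - 1) (by linarith)
  refine ⟨2 ^ p * C, ENNReal.mul_ne_top (two_rpow_ne_top _) hC, ?_⟩
  intro X _ μ 𝒮 ℓ f hf hmeas hfin hinj havg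
  classical
  set E : Set X → Set X := fun S => S ∩ {x | (2 : ℝ≥0∞) ^ ((ℓ S : ℝ) - 1) ≤ f x} with hE
  have hEm : ∀ S ∈ 𝒮, MeasurableSet (E S) := fun S hS =>
    (hmeas S hS).inter (measurableSet_le measurable_const hf)
  have h1 : ∀ S ∈ 𝒮, (2 : ℝ≥0∞) ^ ((ℓ S : ℝ) - 1) * μ S ≤ ∫⁻ x in E S, f x ∂μ := by
    intro S hS
    have e2 : (2 : ℝ≥0∞) ^ (ℓ S : ℝ) * μ S =
        2 ^ ((ℓ S : ℝ) - 1) * μ S + 2 ^ ((ℓ S : ℝ) - 1) * μ S := by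
      rw [show (ℓ S : ℝ) = ((ℓ S : ℝ) - 1) + 1 by ring, two_rpow_add, ENNReal.rpow_one]
      ring_nf
    have e3 : ∫⁻ x in S, f x ∂μ ≤ ∫⁻ x in E S, f x ∂μ + 2 ^ ((ℓ S : ℝ) - 1) * μ S := by
      rw [← lintegral_indicator (hmeas S hS), ← lintegral_indicator (hEm S hS),
        ← lintegral_indicator_const (hmeas S hS), ← lintegral_add_left (hf.indicator (hEm S hS))]
      refine lintegral_mono fun x => ?_
      by_cases hx : x ∈ S
      · by_cases hx2 : (2 : ℝ≥0∞) ^ ((ℓ S : ℝ) - 1) ≤ f x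
        · have : x ∈ E S := ⟨hx, hx2⟩
          simp [hx, this]
        · simp only [Set.indicator_of_mem hx]
          exact le_add_left (not_le.1 hx2).le
      · simp [hx]
    have e4 := (havg S hS).trans e3
    rw [e2] at e4
    exact (ENNReal.add_le_add_iff_right
      (ENNReal.mul_ne_top (two_rpow_ne_top _) (hfin S hS))).1 e4
  have h2 : ∀ x, ∑ S ∈ 𝒮, (E S).indicator (fun x => (2 : ℝ≥0∞) ^ (ℓ S * (p - 1)) * f x) x
      ≤ 2 ^ (p - 1) * C * f x ^ p := by
    intro x
    have hx : ∑ S ∈ 𝒮, (E S).indicator (fun x => (2 : ℝ≥0∞) ^ (ℓ S * (p - 1)) * f x) x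
        = 2 ^ (p - 1) * (∑ S ∈ 𝒮 with x ∈ E S,
            (2 : ℝ≥0∞) ^ (((ℓ S - 1 : ℤ) : ℝ) * (p - 1))) * f x := by
      rw [Finset.mul_sum, Finset.sum_mul, Finset.sum_filter]
      refine Finset.sum_congr rfl fun S _ => ?_
      by_cases h : x ∈ E S
      · rw [Set.indicator_of_mem h, if_pos h, ← two_rpow_add]
        congr 2
        push_cast
        ring
      · rw [Set.indicator_of_notMem h, if_neg h]
    rw [hx]
    calc _ ≤ 2 ^ (p - 1) * (C * f x ^ (p - 1)) * f x := by
          gcongr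
          apply hgeo
          · intro S hS T hT h
            simp only [Finset.coe_filter, Set.mem_ofPred_eq] at hS hT
            exact hinj x ⟨hS.1, hS.2.1⟩ ⟨hT.1, hT.2.1⟩ (by simpa using h)
          · intro S hS
            rw [Finset.mem_filter] at hS
            have := hS.2.2
            simp only [Set.mem_ofPred_eq] at this
            push_cast
            exact this
      _ = 2 ^ (p - 1) * C * (f x ^ (p - 1) * f x ^ (1 : ℝ)) := by
          rw [ENNReal.rpow_one]
          ring
      _ = _ := by
          rw [← ENNReal.rpow_add_of_nonneg _ _ (by linarith) (by norm_num)]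
          simp
  calc ∑ S ∈ 𝒮, (2 : ℝ≥0∞) ^ (ℓ S * p) * μ S
      = ∑ S ∈ 𝒮, 2 * (2 : ℝ≥0∞) ^ (ℓ S * (p - 1)) * (2 ^ ((ℓ S : ℝ) - 1) * μ S) := by
        refine Finset.sum_congr rfl fun S _ => ?_
        rw [← mul_assoc]
        congr 1
        nth_rw 2 [← ENNReal.rpow_one 2]
        rw [← two_rpow_add, ← two_rpow_add]
        congr 1
        ring
    _ ≤ ∑ S ∈ 𝒮, 2 * (2 : ℝ≥0∞) ^ (ℓ S * (p - 1)) * ∫⁻ x in E S, f x ∂μ := by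
        gcongr with S hS
        exact h1 S hS
    _ = 2 * ∫⁻ x, ∑ S ∈ 𝒮, (E S).indicator (fun x => (2 : ℝ≥0∞) ^ (ℓ S * (p - 1)) * f x) x ∂μ := by
        rw [lintegral_finsetSum _ fun S hS => (hf.const_mul _).indicator (hEm S hS),
          Finset.mul_sum]
        refine Finset.sum_congr rfl fun S hS => ?_
        rw [lintegral_indicator (hEm S hS), lintegral_const_mul _ hf, mul_assoc]
    _ ≤ 2 * ∫⁻ x, 2 ^ (p - 1) * C * f x ^ p ∂μ := by
        gcongr with x
        exact h2 x
    _ = _ := by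
        rw [lintegral_const_mul _ (hf.pow_const p), ← mul_assoc, ← mul_assoc]
        nth_rw 1 [← ENNReal.rpow_one 2]
        rw [← two_rpow_add]
        congr 3
        ring

theorem lt_of_two_rpow_lt {s t : ℝ} (h : (2 : ℝ≥0∞) ^ s < 2 ^ t) : s < t := by
  by_contra! hle
  exact absurd (ENNReal.rpow_le_rpow_of_exponent_le (by norm_num) hle) (not_le.2 h)

open scoped Classical in
/-- Global testing implies local testing when `p < q`. -/
theorem exists_local_testing_le {p q : ℝ} (hp : 1 < p) (hpq : p < q) : ∃ C : ℝ≥0∞, C ≠ ⊤ ∧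
    ∀ {X : Type} [MeasurableSpace X] (σ ω : Measure X) (𝒟 : Finset (Set X)) (R : Set X)
      (a : Set X → ℝ≥0∞) (B : ℝ≥0∞), MeasurableSet R → σ R ≠ ⊤ →
      (∀ Q ∈ 𝒟, MeasurableSet Q) → (∀ Q ∈ 𝒟, Q ⊆ R) → (∀ Q ∈ 𝒟, σ Q ≠ 0) →
      (∀ P ∈ 𝒟, ∀ Q ∈ 𝒟, (P ∩ Q).Nonempty → P ⊆ Q ∨ Q ⊆ P) →
      (∀ Q ∈ 𝒟, ∫⁻ x, (∑ P ∈ 𝒟 with Q ⊆ P, P.indicator (fun _ => a P) x) ^ q ∂ω ≤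
        (B * σ Q ^ (1 / p - 1)) ^ q) →
      ∫⁻ x, (∑ Q ∈ 𝒟, Q.indicator (fun _ => a Q * σ Q) x) ^ q ∂ω ≤
        C * (B * σ R ^ (1 / p)) ^ q := by
  have hq : 1 < q := hp.trans hpq
  have hq0 : 0 < q := by linarith
  have hinv : 1 / q < 1 / p := one_div_lt_one_div_of_lt (by linarith) hpq
  set ε : ℝ := (1 / p - 1 / q) / 2 with hε
  have hε0 : 0 < ε := by rw [hε]; linarith
  have hconj := (Real.HolderConjugate.conjExponent hq)
  set q' := q.conjExponent with hq'
  have hq'0 : 0 < q' := hconj.symm.pos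
  set α : ℝ := (1 / p - ε) * q with hα
  have hα1 : 0 < α - 1 := by
    have : 1 / p - ε = 1 / q + ε := by rw [hε]; ring
    rw [hα, this, add_mul, one_div_mul_cancel hq0.ne']
    have := mul_pos hε0 hq0
    linarith
  obtain ⟨C₁, hC₁, hgeo₁⟩ := exists_sum_two_rpow_le (s := ε * q') (mul_pos hε0 hq'0)
  obtain ⟨C₂, hC₂, hgeo₂⟩ := exists_sum_two_rpow_le (s := α - 1) hα1
  refine ⟨2 ^ q * C₁ ^ (q / q') * C₂, ENNReal.mul_ne_top (ENNReal.mul_ne_top (two_rpow_ne_top _)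
    (ENNReal.rpow_ne_top_of_nonneg (by positivity) hC₁)) hC₂, ?_⟩
  intro X _ σ ω 𝒟 R a B hR hRfin hmeas hsub hpos hlam hB
  have hfin : ∀ Q ∈ 𝒟, σ Q ≠ ⊤ := fun Q hQ => ne_top_of_le_ne_top hRfin (measure_mono (hsub Q hQ))
  have hlev : ∀ Q ∈ 𝒟, ∃ n : ℤ, (2 : ℝ≥0∞) ^ (n : ℝ) < σ Q ∧ σ Q ≤ 2 ^ (n + 1 : ℝ) :=
    fun Q hQ => exists_two_rpow_level (hpos Q hQ) (hfin Q hQ)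
  choose! n hn1 hn2 using hlev
  obtain ⟨top, htop⟩ := exists_isStoppingTop 𝒟
    (fun Q hQ => nonempty_of_measure_ne_zero (hpos Q hQ)) hlam (fun Q => - n Q)
  have ht1 := htop.mem
  have ht2 := htop.subset
  have htn : ∀ Q ∈ 𝒟, n (top Q) = n Q := by
    intro Q hQ
    refine le_antisymm (by simpa using htop.level_le Q hQ) ?_
    have h := lt_of_two_rpow_lt
      ((hn1 Q hQ).trans_le ((measure_mono (ht2 Q hQ)).trans (hn2 _ (ht1 Q hQ))))
    have : n Q < n (top Q) + 1 := by exact_mod_cast h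
    omega
  obtain ⟨Pr, hPr⟩ : ∃ Pr : Finset (Set X), ∀ S, S ∈ Pr ↔ S ∈ 𝒟 ∧ top S = S :=
    ⟨𝒟.filter fun S => top S = S, fun S => Finset.mem_filter⟩
  have hPrt : ∀ Q ∈ 𝒟, top Q ∈ Pr := fun Q hQ => (hPr _).2
    ⟨ht1 Q hQ, htop.top_top hQ⟩
  have hPrD : ∀ M ∈ Pr, M ∈ 𝒟 := fun M hM => ((hPr M).1 hM).1
  have hinj : ∀ x, Set.InjOn n {M | M ∈ Pr ∧ x ∈ M} := by
    intro x M hM N hN h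
    exact htop.injOn_level hPr x hM hN (by simp [h])
  set κ : Set X → X → ℝ≥0∞ := fun M x =>
    ∑ Q ∈ 𝒟 with top Q = M, Q.indicator (fun _ => a Q) x with hκ
  have hκm : ∀ M, Measurable (κ M) := fun M => Finset.measurable_fun_sum _ fun Q hQ =>
    measurable_const.indicator (hmeas Q (Finset.mem_filter.1 hQ).1)
  have hκB : ∀ M ∈ Pr, ∫⁻ x, κ M x ^ q ∂ω ≤ (B * 2 ^ (n M * (1 / p - 1))) ^ q := by
    intro M hM
    obtain ⟨Q₀, hQ₀⟩ := (𝒟.filter fun Q => top Q = M).exists_minimal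
      ⟨M, Finset.mem_filter.2 ⟨hPrD M hM, ((hPr M).1 hM).2⟩⟩
    obtain ⟨hQ₀D, hQ₀M⟩ := Finset.mem_filter.1 hQ₀.prop
    have hchain : ∀ Q ∈ 𝒟, top Q = M → Q₀ ⊆ Q := by
      intro Q hQ hQM
      by_cases hne : (Q₀ ∩ Q).Nonempty
      · rcases hlam _ hQ₀D _ hQ hne with h | h
        · exact h
        · exact hQ₀.le_of_le (Finset.mem_filter.2 ⟨hQ, hQM⟩) h
      · exfalso
        have hd : Disjoint Q₀ Q := Set.disjoint_iff_inter_eq_empty.2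
          (Set.not_nonempty_iff_eq_empty.1 hne)
        have hs : σ Q₀ + σ Q ≤ 2 ^ (n M + 1 : ℝ) := by
          rw [← measure_union hd (hmeas Q hQ)]
          refine (measure_mono (Set.union_subset ?_ ?_)).trans (hn2 M (hPrD M hM))
          · rw [← hQ₀M]; exact ht2 _ hQ₀D
          · rw [← hQM]; exact ht2 _ hQ
        have h1 := hn1 _ hQ₀D
        have h2 := hn1 _ hQ
        rw [← htn _ hQ₀D, hQ₀M] at h1
        rw [← htn _ hQ, hQM] at h2
        have h3 := (ENNReal.add_lt_add h1 h2).trans_le hs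
        rw [two_rpow_add, ENNReal.rpow_one, mul_two] at h3
        exact lt_irrefl _ h3
    calc ∫⁻ x, κ M x ^ q ∂ω
        ≤ ∫⁻ x, (∑ P ∈ 𝒟 with Q₀ ⊆ P, P.indicator (fun _ => a P) x) ^ q ∂ω := by
          refine lintegral_mono fun x => ENNReal.rpow_le_rpow ?_ hq0.le
          refine Finset.sum_le_sum_of_subset fun Q hQ => ?_
          rw [Finset.mem_filter] at hQ ⊢
          exact ⟨hQ.1, hchain Q hQ.1 hQ.2⟩
      _ ≤ _ := hB _ hQ₀D
      _ ≤ _ := by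
          gcongr
          have h1 := hn1 _ hQ₀D
          rw [← htn _ hQ₀D, hQ₀M] at h1
          rw [ENNReal.rpow_mul]
          have h1p : 1 / p < 1 := by rw [div_lt_one] <;> linarith
          rw [← neg_sub, ENNReal.rpow_neg, ENNReal.rpow_neg]
          exact ENNReal.inv_le_inv.2 (ENNReal.rpow_le_rpow h1.le (by linarith))
  have hnR : ∀ M ∈ Pr, (2 : ℝ≥0∞) ^ (n M : ℝ) ≤ σ R := fun M hM =>
    (hn1 M (hPrD M hM)).le.trans (measure_mono (hsub M (hPrD M hM)))
  have hpt : ∀ x, (∑ Q ∈ 𝒟, Q.indicator (fun _ => a Q * σ Q) x) ^ q ≤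
      2 ^ q * (C₁ * σ R ^ (ε * q')) ^ (q / q') *
        ∑ M ∈ Pr, (2 ^ (n M * (1 - ε)) * κ M x) ^ q := by
    intro x
    have hu : ∑ M ∈ Pr, (M.indicator (fun _ => (2 : ℝ≥0∞) ^ (n M * ε)) x) ^ q' ≤
        C₁ * σ R ^ (ε * q') := by
      have e : ∑ M ∈ Pr, (M.indicator (fun _ => (2 : ℝ≥0∞) ^ (n M * ε)) x) ^ q' =
          ∑ M ∈ Pr with x ∈ M, (2 : ℝ≥0∞) ^ (n M * (ε * q')) := by
        rw [Finset.sum_filter]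
        refine Finset.sum_congr rfl fun M _ => ?_
        by_cases h : x ∈ M
        · rw [Set.indicator_of_mem h, if_pos h, ← ENNReal.rpow_mul, mul_assoc]
        · rw [Set.indicator_of_notMem h, if_neg h, ENNReal.zero_rpow_of_pos hq'0]
      rw [e]
      refine hgeo₁ _ n _ ?_ fun M hM => hnR M (Finset.mem_filter.1 hM).1
      intro S hS T hT h
      exact hinj x (Finset.mem_filter.1 hS) (Finset.mem_filter.1 hT) h
    have hT : ∑ Q ∈ 𝒟, Q.indicator (fun _ => a Q * σ Q) x ≤
        2 * ∑ M ∈ Pr, M.indicator (fun _ => (2 : ℝ≥0∞) ^ (n M * ε)) x *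
          (2 ^ (n M * (1 - ε)) * κ M x) := by
      rw [← Finset.sum_fiberwise_of_maps_to hPrt, Finset.mul_sum]
      refine Finset.sum_le_sum fun M hM => ?_
      by_cases hx : x ∈ M
      · rw [Set.indicator_of_mem hx, ← mul_assoc (_ ^ _), ← two_rpow_add,
          show (n M * ε + n M * (1 - ε) : ℝ) = n M by ring, hκ, Finset.mul_sum, Finset.mul_sum]
        refine Finset.sum_le_sum fun Q hQ => ?_
        rw [Finset.mem_filter] at hQ
        by_cases hxQ : x ∈ Q
        · rw [Set.indicator_of_mem hxQ, Set.indicator_of_mem hxQ, ← mul_assoc, mul_comm (a Q)]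
          gcongr
          have := hn2 Q hQ.1
          rwa [← htn Q hQ.1, hQ.2, two_rpow_add, ENNReal.rpow_one, mul_comm] at this
        · simp [hxQ]
      · refine le_of_eq_of_le (Finset.sum_eq_zero fun Q hQ => ?_) zero_le
        rw [Finset.mem_filter] at hQ
        refine Set.indicator_of_notMem (fun h => hx ?_) _
        rw [← hQ.2]
        exact ht2 Q hQ.1 h
    calc _ ≤ (2 * ((∑ M ∈ Pr, (M.indicator (fun _ => (2 : ℝ≥0∞) ^ (n M * ε)) x) ^ q') ^ (1 / q') *
          (∑ M ∈ Pr, (2 ^ (n M * (1 - ε)) * κ M x) ^ q) ^ (1 / q))) ^ q :=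
          ENNReal.rpow_le_rpow (hT.trans (by
            gcongr; exact ENNReal.inner_le_Lp_mul_Lq _ _ _ hconj.symm)) hq0.le
      _ ≤ (2 * ((C₁ * σ R ^ (ε * q')) ^ (1 / q') *
          (∑ M ∈ Pr, (2 ^ (n M * (1 - ε)) * κ M x) ^ q) ^ (1 / q))) ^ q := by gcongr
      _ = _ := by
          rw [ENNReal.mul_rpow_of_nonneg _ _ hq0.le, ENNReal.mul_rpow_of_nonneg _ _ hq0.le,
            ← ENNReal.rpow_mul, ← ENNReal.rpow_mul, one_div_mul_cancel hq0.ne', ENNReal.rpow_one,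
            show q / q' = 1 / q' * q by ring, mul_assoc]
  have hsum : ∑ M ∈ Pr, (2 : ℝ≥0∞) ^ (n M * α) ≤ C₂ * σ R ^ α := by
    calc ∑ M ∈ Pr, (2 : ℝ≥0∞) ^ (n M * α)
        ≤ ∑ M ∈ Pr, (2 : ℝ≥0∞) ^ (n M * (α - 1)) * σ M := by
          refine Finset.sum_le_sum fun M hM => ?_
          rw [show (n M * α : ℝ) = n M * (α - 1) + n M by ring, two_rpow_add]
          gcongr
          exact (hn1 M (hPrD M hM)).le
      _ = ∫⁻ x, ∑ M ∈ Pr, M.indicator (fun _ => (2 : ℝ≥0∞) ^ (n M * (α - 1))) x ∂σ := by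
          rw [lintegral_finsetSum _ fun M hM => measurable_const.indicator (hmeas M (hPrD M hM))]
          refine Finset.sum_congr rfl fun M hM => ?_
          rw [lintegral_indicator_const (hmeas M (hPrD M hM))]
      _ ≤ ∫⁻ x, R.indicator (fun _ => C₂ * σ R ^ (α - 1)) x ∂σ := by
          refine lintegral_mono fun x => ?_
          by_cases hx : x ∈ R
          · rw [Set.indicator_of_mem hx]
            have e : ∑ M ∈ Pr, M.indicator (fun _ => (2 : ℝ≥0∞) ^ (n M * (α - 1))) x =
                ∑ M ∈ Pr with x ∈ M, (2 : ℝ≥0∞) ^ (n M * (α - 1)) := by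
              rw [Finset.sum_filter]
              exact Finset.sum_congr rfl fun M _ => Set.indicator_apply _ _ _
            rw [e]
            refine hgeo₂ _ n _ ?_ fun M hM => hnR M (Finset.mem_filter.1 hM).1
            intro S hS T hT h
            exact hinj x (Finset.mem_filter.1 hS) (Finset.mem_filter.1 hT) h
          · refine le_of_eq_of_le (Finset.sum_eq_zero fun M hM => ?_) zero_le
            exact Set.indicator_of_notMem (fun h => hx (hsub M (hPrD M hM) h)) _
      _ = _ := by
          rw [lintegral_indicator_const hR, mul_assoc]
          nth_rw 2 [← ENNReal.rpow_one (σ R)]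
          rw [← ENNReal.rpow_add_of_nonneg _ _ hα1.le (by norm_num)]
          simp
  calc _ ≤ ∫⁻ x, 2 ^ q * (C₁ * σ R ^ (ε * q')) ^ (q / q') *
        ∑ M ∈ Pr, (2 ^ (n M * (1 - ε)) * κ M x) ^ q ∂ω := lintegral_mono hpt
    _ = 2 ^ q * (C₁ * σ R ^ (ε * q')) ^ (q / q') *
        ∑ M ∈ Pr, 2 ^ (n M * ((1 - ε) * q)) * ∫⁻ x, κ M x ^ q ∂ω := by
        rw [lintegral_const_mul _ (Finset.measurable_fun_sum _ fun M _ =>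
            ((hκm M).const_mul _).pow_const q),
          lintegral_finsetSum _ fun M _ => ((hκm M).const_mul _).pow_const q]
        congr 1
        refine Finset.sum_congr rfl fun M _ => ?_
        rw [← lintegral_const_mul _ ((hκm M).pow_const q)]
        refine lintegral_congr fun x => ?_
        rw [ENNReal.mul_rpow_of_nonneg _ _ hq0.le, ← ENNReal.rpow_mul, mul_assoc]
    _ ≤ 2 ^ q * (C₁ * σ R ^ (ε * q')) ^ (q / q') *
        ∑ M ∈ Pr, 2 ^ (n M * ((1 - ε) * q)) * (B * 2 ^ (n M * (1 / p - 1))) ^ q := by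
        gcongr with M hM
        exact hκB M hM
    _ = 2 ^ q * (C₁ * σ R ^ (ε * q')) ^ (q / q') * (B ^ q * ∑ M ∈ Pr, 2 ^ (n M * α)) := by
        congr 1
        rw [Finset.mul_sum]
        refine Finset.sum_congr rfl fun M _ => ?_
        rw [ENNReal.mul_rpow_of_nonneg _ _ hq0.le, ← ENNReal.rpow_mul, mul_left_comm,
          ← two_rpow_add]
        congr 2
        rw [hα]
        ring
    _ ≤ 2 ^ q * (C₁ * σ R ^ (ε * q')) ^ (q / q') * (B ^ q * (C₂ * σ R ^ α)) := by gcongr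
    _ = _ := by
        have hqq' : 0 < q / q' := by positivity
        rw [ENNReal.mul_rpow_of_nonneg _ _ hqq'.le, ENNReal.mul_rpow_of_nonneg _ _ hq0.le,
          ← ENNReal.rpow_mul, ← ENNReal.rpow_mul]
        have e : σ R ^ (1 / p * q) = σ R ^ (ε * q' * (q / q')) * σ R ^ α := by
          rw [← ENNReal.rpow_add_of_nonneg _ _ (by positivity) (by linarith)]
          congr 1
          rw [hα]
          field_simp
          ring
        rw [e]
        ring

theorem sum_rpow_le_rpow_sum {ι : Type} (t : Finset ι) (z : ι → ℝ≥0∞) {s : ℝ} (hs : 1 ≤ s) :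
    ∑ i ∈ t, z i ^ s ≤ (∑ i ∈ t, z i) ^ s := by
  have h : ∀ y : ℝ≥0∞, y ^ s = y * y ^ (s - 1) := fun y => by
    nth_rw 2 [← ENNReal.rpow_one y]
    rw [← ENNReal.rpow_add_of_nonneg _ _ (by norm_num) (by linarith)]
    congr 1
    ring
  rw [h, Finset.sum_mul]
  refine Finset.sum_le_sum fun i hi => ?_
  rw [h]
  gcongr
  exact Finset.single_le_sum (f := z) (fun _ _ => zero_le) hi

open scoped Classical in
/-- The part of the bilinear form where the stopping sets of `g` lie inside those of `f`. -/
theorem exists_sum_nested_le {p q r : ℝ} (hp : 1 < p) (hpq : p < q) (hqr : q.HolderConjugate r) :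
    ∃ C : ℝ≥0∞, C ≠ ⊤ ∧
    ∀ {X : Type} [MeasurableSpace X] (σ ω : Measure X) (𝒟 ℋ : Finset (Set X))
      (a : Set X → ℝ≥0∞) (B : ℝ≥0∞) (f g : X → ℝ≥0∞) (ℓ ℓ' : Set X → ℤ)
      (top top' : Set X → Set X),
      Measurable f → Measurable g → ∫⁻ x, f x ^ p ∂σ ≤ 1 → ∫⁻ x, g x ^ r ∂ω ≤ 1 →
      (∀ Q ∈ 𝒟, MeasurableSet Q) → (∀ Q ∈ 𝒟, σ Q ≠ 0) → (∀ Q ∈ 𝒟, σ Q ≠ ⊤) →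
      (∀ Q ∈ 𝒟, ω Q ≠ ⊤) →
      (∀ P ∈ 𝒟, ∀ Q ∈ 𝒟, (P ∩ Q).Nonempty → P ⊆ Q ∨ Q ⊆ P) →
      (∀ Q ∈ 𝒟, ∫⁻ x, (∑ P ∈ 𝒟 with Q ⊆ P, P.indicator (fun _ => a P) x) ^ q ∂ω ≤
        (B * σ Q ^ (1 / p - 1)) ^ q) →
      IsStoppingTop 𝒟 ℓ top → IsStoppingTop 𝒟 ℓ' top' →
      (∀ Q ∈ 𝒟, (2 : ℝ≥0∞) ^ (ℓ Q : ℝ) * σ Q ≤ ∫⁻ x in Q, f x ∂σ) →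
      (∀ Q ∈ 𝒟, ∫⁻ x in Q, f x ∂σ ≤ (2 : ℝ≥0∞) ^ (ℓ Q + 1 : ℝ) * σ Q) →
      (∀ Q ∈ 𝒟, (2 : ℝ≥0∞) ^ (ℓ' Q : ℝ) * ω Q ≤ ∫⁻ x in Q, g x ∂ω) →
      (∀ Q ∈ 𝒟, ∫⁻ x in Q, g x ∂ω ≤ (2 : ℝ≥0∞) ^ (ℓ' Q + 1 : ℝ) * ω Q) →
      (∀ Q ∈ ℋ, Q ∈ 𝒟 ∧ top' Q ⊆ top Q) →
      ∑ Q ∈ ℋ, a Q * (∫⁻ x in Q, f x ∂σ) * (∫⁻ x in Q, g x ∂ω) ≤ C * B := by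
  have hp0 : 0 < p := by linarith
  have hq0 : 0 < q := by linarith
  have hr0 : 0 < r := hqr.symm.pos
  have hqi : 0 ≤ 1 / q := by positivity
  have hri : 0 ≤ 1 / r := by positivity
  have hpi : 0 ≤ 1 / p := by positivity
  obtain ⟨C₀, hC₀, hloc⟩ := exists_local_testing_le hp hpq
  obtain ⟨C₁, hC₁, hpack₁⟩ := exists_packing_le hp
  obtain ⟨C₂, hC₂, hpack₂⟩ := exists_packing_le hqr.symm.lt
  refine ⟨4 * C₀ ^ (1 / q) * (C₁ ^ (1 / p) * C₂ ^ (1 / r)), by finiteness, ?_⟩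
  intro X _ σ ω 𝒟 ℋ a B f g ℓ ℓ' top top' hf hg hf1 hg1 hmeas hσ0 hσt hωt hlam hB htop htop'
    hfl hfu hgl hgu hℋ
  obtain ⟨Pr, hPr⟩ : ∃ Pr : Finset (Set X), ∀ S, S ∈ Pr ↔ S ∈ 𝒟 ∧ top S = S :=
    ⟨𝒟.filter fun S => top S = S, fun S => Finset.mem_filter⟩
  obtain ⟨Pr', hPr'⟩ : ∃ Pr' : Finset (Set X), ∀ S, S ∈ Pr' ↔ S ∈ 𝒟 ∧ top' S = S :=
    ⟨𝒟.filter fun S => top' S = S, fun S => Finset.mem_filter⟩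
  set T : Set X → X → ℝ≥0∞ := fun S x =>
    ∑ Q ∈ 𝒟 with Q ⊆ S, Q.indicator (fun _ => a Q * σ Q) x with hT
  set h : Set X → X → ℝ≥0∞ := fun S x =>
    (Pr'.filter fun S' => top S' = S).sup fun S' =>
      S'.indicator (fun _ => (2 : ℝ≥0∞) ^ (ℓ' S' : ℝ)) x with hh
  have hTm : ∀ S, Measurable (T S) := fun S => Finset.measurable_fun_sum _ fun Q hQ =>
    measurable_const.indicator (hmeas Q (Finset.mem_filter.1 hQ).1)
  have hhm : ∀ S, Measurable (h S) := by
    intro S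
    have e : h S = (Pr'.filter fun S' => top S' = S).sup fun S' =>
        S'.indicator (fun _ => (2 : ℝ≥0∞) ^ (ℓ' S' : ℝ)) := by
      ext x
      rw [Finset.sup_apply]
    rw [e]
    refine Finset.sup_induction (p := Measurable) measurable_const (fun _ h₁ _ h₂ => h₁.sup h₂)
      fun S' hS' => measurable_const.indicator (hmeas S' ?_)
    exact ((hPr' _).1 (Finset.mem_filter.1 hS').1).1
  have hTq : ∀ S ∈ Pr, (∫⁻ x, T S x ^ q ∂ω) ^ (1 / q) ≤ C₀ ^ (1 / q) * (B * σ S ^ (1 / p)) := by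
    intro S hS
    have hSD := ((hPr S).1 hS).1
    have := hloc σ ω (𝒟.filter (· ⊆ S)) S a B (hmeas S hSD) (hσt S hSD)
      (fun Q hQ => hmeas Q (Finset.mem_filter.1 hQ).1) (fun Q hQ => (Finset.mem_filter.1 hQ).2)
      (fun Q hQ => hσ0 Q (Finset.mem_filter.1 hQ).1)
      (fun P hP Q hQ => hlam P (Finset.mem_filter.1 hP).1 Q (Finset.mem_filter.1 hQ).1)
      (fun Q hQ => le_trans (lintegral_mono fun x => ENNReal.rpow_le_rpow
        (Finset.sum_le_sum_of_subset (Finset.filter_subset_filter _ (Finset.filter_subset _ _)))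
        hq0.le) (hB Q (Finset.mem_filter.1 hQ).1))
    calc _ ≤ (C₀ * (B * σ S ^ (1 / p)) ^ q) ^ (1 / q) := ENNReal.rpow_le_rpow this hqi
      _ = _ := by
        rw [ENNReal.mul_rpow_of_nonneg _ _ hqi, ← ENNReal.rpow_mul, mul_one_div_cancel hq0.ne',
          ENNReal.rpow_one]
  have hpiece : ∀ S ∈ Pr, ∑ Q ∈ ℋ with top Q = S,
      a Q * (∫⁻ x in Q, f x ∂σ) * (∫⁻ x in Q, g x ∂ω) ≤
      4 * 2 ^ (ℓ S : ℝ) * ∫⁻ x, T S x * h S x ∂ω := by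
    intro S hS
    calc ∑ Q ∈ ℋ with top Q = S, a Q * (∫⁻ x in Q, f x ∂σ) * (∫⁻ x in Q, g x ∂ω)
        ≤ ∑ Q ∈ ℋ with top Q = S, 4 * 2 ^ (ℓ S : ℝ) *
            ∫⁻ x, Q.indicator (fun _ => a Q * σ Q * 2 ^ (ℓ' (top' Q) : ℝ)) x ∂ω := by
          refine Finset.sum_le_sum fun Q hQ => ?_
          obtain ⟨hQℋ, hQS⟩ := Finset.mem_filter.1 hQ
          have hQ := (hℋ Q hQℋ).1
          rw [lintegral_indicator_const (hmeas Q hQ)]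
          have h1 : ∫⁻ x in Q, f x ∂σ ≤ 2 * 2 ^ (ℓ S : ℝ) * σ Q := by
            refine (hfu Q hQ).trans ?_
            rw [two_rpow_add, ENNReal.rpow_one, mul_comm _ (2 : ℝ≥0∞)]
            gcongr
            · norm_num
            · rw [← hQS]; exact htop.level_le Q hQ
          have h2 : ∫⁻ x in Q, g x ∂ω ≤ 2 * 2 ^ (ℓ' (top' Q) : ℝ) * ω Q := by
            refine (hgu Q hQ).trans ?_
            rw [two_rpow_add, ENNReal.rpow_one, mul_comm _ (2 : ℝ≥0∞)]
            gcongr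
            · norm_num
            · exact htop'.level_le Q hQ
          calc _ ≤ a Q * (2 * 2 ^ (ℓ S : ℝ) * σ Q) * (2 * 2 ^ (ℓ' (top' Q) : ℝ) * ω Q) := by gcongr
            _ = _ := by ring
      _ = 4 * 2 ^ (ℓ S : ℝ) * ∫⁻ x, ∑ Q ∈ ℋ with top Q = S,
            Q.indicator (fun _ => a Q * σ Q * 2 ^ (ℓ' (top' Q) : ℝ)) x ∂ω := by
          rw [lintegral_finsetSum _ fun Q hQ => measurable_const.indicator
            (hmeas Q (hℋ Q (Finset.mem_filter.1 hQ).1).1), Finset.mul_sum]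
      _ ≤ _ := by
          gcongr with x
          calc ∑ Q ∈ ℋ with top Q = S, Q.indicator (fun _ => a Q * σ Q * 2 ^ (ℓ' (top' Q) : ℝ)) x
              ≤ ∑ Q ∈ ℋ with top Q = S, Q.indicator (fun _ => a Q * σ Q) x * h S x := by
                refine Finset.sum_le_sum fun Q hQ => ?_
                obtain ⟨hQℋ, hQS⟩ := Finset.mem_filter.1 hQ
                obtain ⟨hQD, hQt⟩ := hℋ Q hQℋ
                by_cases hx : x ∈ Q
                · rw [Set.indicator_of_mem hx, Set.indicator_of_mem hx]
                  gcongr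
                  have hmem : top' Q ∈ Pr'.filter fun S' => top S' = S := by
                    refine Finset.mem_filter.2 ⟨(hPr' _).2 ⟨htop'.mem Q hQD, htop'.top_top hQD⟩, ?_⟩
                    rw [← hQS]
                    exact htop.top_eq_of_subset Q hQD _ (htop'.mem Q hQD) (htop'.subset Q hQD) hQt
                  have := Finset.le_sup
                    (f := fun S' => S'.indicator (fun _ => (2 : ℝ≥0∞) ^ (ℓ' S' : ℝ)) x) hmem
                  simpa only [hh, Set.indicator_of_mem (htop'.subset Q hQD hx)] using this
                · simp [hx]
            _ = (∑ Q ∈ ℋ with top Q = S, Q.indicator (fun _ => a Q * σ Q) x) * h S x := by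
                rw [Finset.sum_mul]
            _ ≤ T S x * h S x := by
                gcongr
                refine Finset.sum_le_sum_of_subset fun Q hQ => ?_
                obtain ⟨hQℋ, hQS⟩ := Finset.mem_filter.1 hQ
                refine Finset.mem_filter.2 ⟨(hℋ Q hQℋ).1, ?_⟩
                rw [← hQS]
                exact htop.subset Q (hℋ Q hQℋ).1
  have hhr : ∑ S ∈ Pr, ((∫⁻ x, h S x ^ r ∂ω) ^ (1 / r)) ^ r ≤ C₂ := by
    calc ∑ S ∈ Pr, ((∫⁻ x, h S x ^ r ∂ω) ^ (1 / r)) ^ r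
        = ∑ S ∈ Pr, ∫⁻ x, h S x ^ r ∂ω := by
          refine Finset.sum_congr rfl fun S _ => ?_
          rw [← ENNReal.rpow_mul, one_div_mul_cancel hr0.ne', ENNReal.rpow_one]
      _ ≤ ∑ S ∈ Pr, ∑ S' ∈ Pr' with top S' = S, 2 ^ (ℓ' S' * r) * ω S' := by
          refine Finset.sum_le_sum fun S _ => ?_
          calc ∫⁻ x, h S x ^ r ∂ω
              ≤ ∫⁻ x, ∑ S' ∈ Pr' with top S' = S,
                  S'.indicator (fun _ => (2 : ℝ≥0∞) ^ (ℓ' S' * r)) x ∂ω := by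
                refine lintegral_mono fun x => ?_
                rw [← ENNReal.le_rpow_inv_iff hr0, hh]
                refine Finset.sup_le fun S' hS' => ?_
                rw [ENNReal.le_rpow_inv_iff hr0]
                refine le_trans (le_of_eq ?_) (Finset.single_le_sum (f := fun S' : Set X =>
                  S'.indicator (fun _ => (2 : ℝ≥0∞) ^ (ℓ' S' * r)) x) (fun _ _ => zero_le) hS')
                by_cases hx : x ∈ S'
                · rw [Set.indicator_of_mem hx, Set.indicator_of_mem hx, ENNReal.rpow_mul]
                · simp [hx, hr0]
            _ = _ := by
                have hm : ∀ S' ∈ Pr'.filter fun S' => top S' = S, MeasurableSet S' := fun S' hS' =>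
                  hmeas S' ((hPr' _).1 (Finset.mem_filter.1 hS').1).1
                rw [lintegral_finsetSum _ fun S' hS' => measurable_const.indicator (hm S' hS')]
                refine Finset.sum_congr rfl fun S' hS' => ?_
                rw [lintegral_indicator_const (hm S' hS')]
      _ = ∑ S' ∈ Pr', 2 ^ (ℓ' S' * r) * ω S' := Finset.sum_fiberwise_of_maps_to
          (fun S' hS' => (hPr _).2 ⟨htop.mem _ ((hPr' _).1 hS').1,
            htop.top_top ((hPr' _).1 hS').1⟩) _
      _ ≤ C₂ * ∫⁻ x, g x ^ r ∂ω := hpack₂ ω Pr' ℓ' g hg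
          (fun S hS => hmeas S ((hPr' _).1 hS).1) (fun S hS => hωt S ((hPr' _).1 hS).1)
          (htop'.injOn_level hPr') (fun S hS => hgl S ((hPr' _).1 hS).1)
      _ ≤ C₂ := mul_le_of_le_one_right zero_le hg1
  have hfp : ∑ S ∈ Pr, (2 ^ (ℓ S : ℝ) * σ S ^ (1 / p)) ^ q ≤ C₁ ^ (q / p) := by
    calc ∑ S ∈ Pr, (2 ^ (ℓ S : ℝ) * σ S ^ (1 / p)) ^ q
        = ∑ S ∈ Pr, (2 ^ (ℓ S * p) * σ S) ^ (q / p) := by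
          refine Finset.sum_congr rfl fun S _ => ?_
          rw [ENNReal.mul_rpow_of_nonneg _ _ hq0.le,
            ENNReal.mul_rpow_of_nonneg _ _ (by positivity : 0 ≤ q / p), ← ENNReal.rpow_mul,
            ← ENNReal.rpow_mul, ← ENNReal.rpow_mul]
          congr 2 <;> field_simp
      _ ≤ (∑ S ∈ Pr, 2 ^ (ℓ S * p) * σ S) ^ (q / p) :=
          sum_rpow_le_rpow_sum _ _ ((one_le_div hp0).2 hpq.le)
      _ ≤ (C₁ * ∫⁻ x, f x ^ p ∂σ) ^ (q / p) := by
          refine ENNReal.rpow_le_rpow ?_ (by positivity)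
          exact hpack₁ σ Pr ℓ f hf
            (fun S hS => hmeas S ((hPr _).1 hS).1) (fun S hS => hσt S ((hPr _).1 hS).1)
            (htop.injOn_level hPr) (fun S hS => hfl S ((hPr _).1 hS).1)
      _ ≤ _ := ENNReal.rpow_le_rpow (mul_le_of_le_one_right zero_le hf1) (by positivity)
  calc ∑ Q ∈ ℋ, a Q * (∫⁻ x in Q, f x ∂σ) * (∫⁻ x in Q, g x ∂ω)
      = ∑ S ∈ Pr, ∑ Q ∈ ℋ with top Q = S, a Q * (∫⁻ x in Q, f x ∂σ) * (∫⁻ x in Q, g x ∂ω) :=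
        (Finset.sum_fiberwise_of_maps_to (fun Q hQ => (hPr _).2
          ⟨htop.mem _ (hℋ Q hQ).1, htop.top_top (hℋ Q hQ).1⟩) _).symm
    _ ≤ ∑ S ∈ Pr, 4 * 2 ^ (ℓ S : ℝ) * (C₀ ^ (1 / q) * (B * σ S ^ (1 / p)) *
          (∫⁻ x, h S x ^ r ∂ω) ^ (1 / r)) := by
        refine Finset.sum_le_sum fun S hS => (hpiece S hS).trans ?_
        gcongr
        refine (ENNReal.lintegral_mul_le_Lp_mul_Lq ω hqr (hTm S).aemeasurable
          (hhm S).aemeasurable).trans ?_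
        gcongr
        exact hTq S hS
    _ = 4 * C₀ ^ (1 / q) * B * ∑ S ∈ Pr, (2 ^ (ℓ S : ℝ) * σ S ^ (1 / p)) *
          (∫⁻ x, h S x ^ r ∂ω) ^ (1 / r) := by
        rw [Finset.mul_sum]
        exact Finset.sum_congr rfl fun S _ => by ring
    _ ≤ 4 * C₀ ^ (1 / q) * B * ((C₁ ^ (q / p)) ^ (1 / q) * C₂ ^ (1 / r)) := by
        gcongr
        refine (ENNReal.inner_le_Lp_mul_Lq _ _ _ hqr).trans ?_
        gcongr
    _ = _ := by
        rw [← ENNReal.rpow_mul, show q / p * (1 / q) = 1 / p by field_simp]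
        ring

theorem exists_level {X : Type} [MeasurableSpace X] {μ : Measure X} {f : X → ℝ≥0∞} {p : ℝ}
    (hp : 1 < p) (hf1 : ∫⁻ x, f x ^ p ∂μ ≤ 1) {Q : Set X}
    (hμt : μ Q ≠ ⊤) (h0 : ∫⁻ x in Q, f x ∂μ ≠ 0) :
    ∃ n : ℤ, (2 : ℝ≥0∞) ^ (n : ℝ) * μ Q ≤ ∫⁻ x in Q, f x ∂μ ∧
      ∫⁻ x in Q, f x ∂μ ≤ (2 : ℝ≥0∞) ^ (n + 1 : ℝ) * μ Q := by
  have hμ0 : μ Q ≠ 0 := fun h => h0 (setLIntegral_measure_zero _ _ h)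
  have ht : ∫⁻ x in Q, f x ∂μ ≠ ⊤ := by
    refine ne_top_of_le_ne_top (b := μ Q + 1) (by finiteness) ?_
    calc ∫⁻ x in Q, f x ∂μ ≤ ∫⁻ x in Q, (1 + f x ^ p) ∂μ := by
          refine lintegral_mono fun x => ?_
          rcases le_total (f x) 1 with h | h
          · exact h.trans le_self_add
          · exact (ENNReal.le_rpow_self_of_one_le h hp.le).trans le_add_self
      _ ≤ μ Q + 1 := by
          rw [lintegral_add_left measurable_const, lintegral_one, Measure.restrict_apply_univ]
          gcongr
          exact (setLIntegral_le_lintegral _ _).trans hf1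
  obtain ⟨n, h1, h2⟩ := exists_two_rpow_level (ENNReal.div_ne_zero.2 ⟨h0, hμt⟩)
    (ENNReal.div_ne_top ht hμ0)
  exact ⟨n, (ENNReal.le_div_iff_mul_le (Or.inl hμ0) (Or.inl hμt)).1 h1.le,
    (ENNReal.div_le_iff hμ0 hμt).1 h2⟩

open scoped Classical in
/-- A positive bilinear form over a laminar family is controlled by its two global testing
constants. -/
theorem exists_bilinear_le {p q p' r : ℝ} (hp : 1 < p) (hpq : p < q)
    (hpp : p.HolderConjugate p') (hqr : q.HolderConjugate r) :
    ∃ C : ℝ≥0∞, C ≠ ⊤ ∧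
    ∀ {X : Type} [MeasurableSpace X] (σ ω : Measure X) (𝒟 : Finset (Set X))
      (a : Set X → ℝ≥0∞) (A B : ℝ≥0∞) (f g : X → ℝ≥0∞),
      Measurable f → Measurable g → ∫⁻ x, f x ^ p ∂σ ≤ 1 → ∫⁻ x, g x ^ r ∂ω ≤ 1 →
      (∀ Q ∈ 𝒟, MeasurableSet Q) → (∀ Q ∈ 𝒟, σ Q ≠ ⊤) → (∀ Q ∈ 𝒟, ω Q ≠ ⊤) →
      (∀ P ∈ 𝒟, ∀ Q ∈ 𝒟, (P ∩ Q).Nonempty → P ⊆ Q ∨ Q ⊆ P) →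
      (∀ Q ∈ 𝒟, ω Q ≠ 0 →
        ∫⁻ x, (∑ P ∈ 𝒟 with Q ⊆ P, P.indicator (fun _ => a P) x) ^ p' ∂σ ≤
        (A * ω Q ^ (1 / r - 1)) ^ p') →
      (∀ Q ∈ 𝒟, σ Q ≠ 0 →
        ∫⁻ x, (∑ P ∈ 𝒟 with Q ⊆ P, P.indicator (fun _ => a P) x) ^ q ∂ω ≤
        (B * σ Q ^ (1 / p - 1)) ^ q) →
      ∑ Q ∈ 𝒟, a Q * (∫⁻ x in Q, f x ∂σ) * (∫⁻ x in Q, g x ∂ω) ≤ C * (A + B) := by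
  have hr1 : 1 < r := hqr.symm.lt
  have hrp' : r < p' := by
    have h1 := hpp.inv_add_inv_eq_one
    have h2 := hqr.inv_add_inv_eq_one
    have h3 : q⁻¹ < p⁻¹ := by gcongr
    exact (inv_lt_inv₀ hpp.symm.pos hqr.symm.pos).1 (by linarith)
  obtain ⟨C₁, hC₁, hnest₁⟩ := exists_sum_nested_le hp hpq hqr
  obtain ⟨C₂, hC₂, hnest₂⟩ := exists_sum_nested_le hr1 hrp' hpp.symm
  refine ⟨C₁ + C₂, by finiteness, ?_⟩
  intro X _ σ ω 𝒟 a A B f g hf hg hf1 hg1 hmeas hσt hωt hlam hA hB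
  obtain ⟨ℰ, hℰ⟩ : ∃ ℰ : Finset (Set X), ∀ Q, Q ∈ ℰ ↔
      Q ∈ 𝒟 ∧ ∫⁻ x in Q, f x ∂σ ≠ 0 ∧ ∫⁻ x in Q, g x ∂ω ≠ 0 :=
    ⟨𝒟.filter fun Q => ∫⁻ x in Q, f x ∂σ ≠ 0 ∧ ∫⁻ x in Q, g x ∂ω ≠ 0, fun Q => Finset.mem_filter⟩
  have hsub : ℰ ⊆ 𝒟 := fun Q hQ => ((hℰ Q).1 hQ).1
  have hσ0 : ∀ Q ∈ ℰ, σ Q ≠ 0 := fun Q hQ h =>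
    ((hℰ Q).1 hQ).2.1 (setLIntegral_measure_zero _ _ h)
  have hω0 : ∀ Q ∈ ℰ, ω Q ≠ 0 := fun Q hQ h =>
    ((hℰ Q).1 hQ).2.2 (setLIntegral_measure_zero _ _ h)
  have hne : ∀ Q ∈ ℰ, Q.Nonempty := fun Q hQ => nonempty_of_measure_ne_zero (hσ0 Q hQ)
  have hlam' : ∀ P ∈ ℰ, ∀ Q ∈ ℰ, (P ∩ Q).Nonempty → P ⊆ Q ∨ Q ⊆ P :=
    fun P hP Q hQ => hlam P (hsub hP) Q (hsub hQ)
  have hmeas' : ∀ Q ∈ ℰ, MeasurableSet Q := fun Q hQ => hmeas Q (hsub hQ)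
  have hA' : ∀ Q ∈ ℰ, ∫⁻ x, (∑ P ∈ ℰ with Q ⊆ P, P.indicator (fun _ => a P) x) ^ p' ∂σ ≤
      (A * ω Q ^ (1 / r - 1)) ^ p' := fun Q hQ =>
    (lintegral_mono fun x => ENNReal.rpow_le_rpow (Finset.sum_le_sum_of_subset
      (Finset.filter_subset_filter _ hsub)) hpp.symm.pos.le).trans (hA Q (hsub hQ) (hω0 Q hQ))
  have hB' : ∀ Q ∈ ℰ, ∫⁻ x, (∑ P ∈ ℰ with Q ⊆ P, P.indicator (fun _ => a P) x) ^ q ∂ω ≤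
      (B * σ Q ^ (1 / p - 1)) ^ q := fun Q hQ =>
    (lintegral_mono fun x => ENNReal.rpow_le_rpow (Finset.sum_le_sum_of_subset
      (Finset.filter_subset_filter _ hsub)) hqr.pos.le).trans (hB Q (hsub hQ) (hσ0 Q hQ))
  have hlev : ∀ Q ∈ ℰ, _ := fun Q hQ =>
    exists_level hp hf1 (hσt Q (hsub hQ)) ((hℰ Q).1 hQ).2.1
  have hlev' : ∀ Q ∈ ℰ, _ := fun Q hQ =>
    exists_level hr1 hg1 (hωt Q (hsub hQ)) ((hℰ Q).1 hQ).2.2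
  choose! ℓ hℓl hℓu using hlev
  choose! ℓ' hℓl' hℓu' using hlev'
  obtain ⟨top, htop⟩ := exists_isStoppingTop ℰ hne hlam' ℓ
  obtain ⟨top', htop'⟩ := exists_isStoppingTop ℰ hne hlam' ℓ'
  have h₁ := hnest₁ σ ω ℰ (ℰ.filter fun Q => top' Q ⊆ top Q) a B f g ℓ ℓ' top top' hf hg hf1 hg1
    hmeas' hσ0 (fun Q hQ => hσt Q (hsub hQ)) (fun Q hQ => hωt Q (hsub hQ)) hlam' hB' htop htop'
    hℓl hℓu hℓl' hℓu' fun Q hQ => Finset.mem_filter.1 hQ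
  have h₂ := hnest₂ ω σ ℰ (ℰ.filter fun Q => top Q ⊆ top' Q) a A g f ℓ' ℓ top' top hg hf hg1 hf1
    hmeas' hω0 (fun Q hQ => hωt Q (hsub hQ)) (fun Q hQ => hσt Q (hsub hQ)) hlam' hA' htop' htop
    hℓl' hℓu' hℓl hℓu fun Q hQ => Finset.mem_filter.1 hQ
  calc ∑ Q ∈ 𝒟, a Q * (∫⁻ x in Q, f x ∂σ) * (∫⁻ x in Q, g x ∂ω)
      = ∑ Q ∈ ℰ, a Q * (∫⁻ x in Q, f x ∂σ) * (∫⁻ x in Q, g x ∂ω) := by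
        refine (Finset.sum_subset hsub fun Q hQ hQn => ?_).symm
        by_contra hne0
        refine hQn ((hℰ Q).2 ⟨hQ, fun h => hne0 (by simp [h]), fun h => hne0 (by simp [h])⟩)
    _ ≤ ∑ Q ∈ ℰ.filter (fun Q => top' Q ⊆ top Q) ∪ ℰ.filter (fun Q => top Q ⊆ top' Q),
          a Q * (∫⁻ x in Q, f x ∂σ) * (∫⁻ x in Q, g x ∂ω) := by
        refine Finset.sum_le_sum_of_subset fun Q hQ => ?_
        obtain ⟨x, hx⟩ := hne Q hQ
        have := hlam' _ (htop'.mem Q hQ) _ (htop.mem Q hQ)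
          ⟨x, htop'.subset Q hQ hx, htop.subset Q hQ hx⟩
        simpa [hQ] using this
    _ ≤ C₁ * B + C₂ * A := by
        refine (le_self_add.trans Finset.sum_union_inter.le).trans ?_
        refine add_le_add h₁ (le_of_eq_of_le (Finset.sum_congr rfl fun Q _ => ?_) h₂)
        ring
    _ ≤ (C₁ + C₂) * (A + B) := by
        rw [add_mul]
        gcongr
        · exact le_add_self
        · exact le_self_add

/-- The `L^q` norm is dominated by any bound for the pairing with the unit ball of `L^r`. -/
theorem lintegral_rpow_le_of_forall_pairing_le {X : Type} [MeasurableSpace X] {μ : Measure X}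
    [SigmaFinite μ] {q r : ℝ} (hqr : q.HolderConjugate r) {φ : X → ℝ≥0∞} (hφ : Measurable φ)
    {K : ℝ≥0∞}
    (h : ∀ g : X → ℝ≥0∞, Measurable g → ∫⁻ x, g x ^ r ∂μ ≤ 1 → ∫⁻ x, φ x * g x ∂μ ≤ K) :
    (∫⁻ x, φ x ^ q ∂μ) ^ (1 / q) ≤ K := by
  have hq0 : 0 < q := hqr.pos
  have hr0 : 0 < r := hqr.symm.pos
  have hq1 : 1 < q := hqr.lt
  set ψ : ℕ → X → ℝ≥0∞ := fun n => (spanningSets μ n).indicator fun x => min (φ x) n with hψ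
  have hψm : ∀ n, Measurable (ψ n) := fun n =>
    (hφ.min measurable_const).indicator (measurableSet_spanningSets μ n)
  have hψmono : Monotone ψ := by
    intro m n hmn x
    refine Set.indicator_le_indicator_of_subset (monotone_spanningSets μ hmn)
      (fun _ => zero_le) x |>.trans (Set.indicator_le_indicator ?_)
    exact min_le_min_left _ (by exact_mod_cast hmn)
  have hψle : ∀ n x, ψ n x ≤ φ x := fun n x =>
    Set.indicator_le' (fun _ _ => min_le_left _ _) (fun _ _ => zero_le) x
  have hψsup : ∀ x, ⨆ n, ψ n x = φ x := by
    intro x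
    refine le_antisymm (iSup_le fun n => hψle n x) (le_of_forall_lt fun c hc => ?_)
    obtain ⟨n, hn⟩ := ENNReal.exists_nat_gt hc.ne_top
    obtain ⟨m, hm⟩ : ∃ m, x ∈ spanningSets μ m := by
      have : x ∈ ⋃ m, spanningSets μ m := by rw [iUnion_spanningSets]; trivial
      exact Set.mem_iUnion.1 this
    refine lt_of_lt_of_le ?_ (le_iSup _ (max m n))
    rw [hψ]
    dsimp only
    rw [Set.indicator_of_mem (monotone_spanningSets μ (le_max_left m n) hm)]
    exact lt_min hc (hn.trans_le (by exact_mod_cast le_max_right m n))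
  have hint : ∀ n, ∫⁻ x, ψ n x ^ q ∂μ ≠ ⊤ := by
    intro n
    refine ne_top_of_le_ne_top (b := (n : ℝ≥0∞) ^ q * μ (spanningSets μ n)) ?_ ?_
    · have := (measure_spanningSets_lt_top μ n).ne
      finiteness
    · rw [← lintegral_indicator_const (measurableSet_spanningSets μ n)]
      refine lintegral_mono fun x => ?_
      by_cases hx : x ∈ spanningSets μ n
      · rw [hψ]
        dsimp only
        rw [Set.indicator_of_mem hx, Set.indicator_of_mem hx]
        exact ENNReal.rpow_le_rpow (min_le_right _ _) hq0.le
      · simp [hψ, hx, hq0]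
  have hbd : ∀ n, ∫⁻ x, ψ n x ^ q ∂μ ≤ K ^ q := by
    intro n
    set I := ∫⁻ x, ψ n x ^ q ∂μ with hI
    rcases eq_or_ne I 0 with h0 | h0
    · simp [h0]
    have hIr : I ^ (-(1 / r)) ≠ ⊤ := ENNReal.rpow_ne_top_of_ne_zero h0 (hint n)
    have := h (fun x => I ^ (-(1 / r)) * ψ n x ^ (q - 1)) (((hψm n).pow_const _).const_mul _) ?_
    · have h2 : I ^ (1 / q) ≤ K := by
        refine le_trans ?_ this
        calc I ^ (1 / q) = I ^ (-(1 / r)) * I := by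
              nth_rw 3 [← ENNReal.rpow_one I]
              rw [← ENNReal.rpow_add _ _ h0 (hint n)]
              congr 1
              have := hqr.inv_add_inv_eq_one
              rw [one_div, one_div]
              linarith
          _ = ∫⁻ x, I ^ (-(1 / r)) * ψ n x ^ q ∂μ := by
              rw [lintegral_const_mul _ ((hψm n).pow_const _)]
          _ ≤ _ := by
              refine lintegral_mono fun x => ?_
              calc I ^ (-(1 / r)) * ψ n x ^ q = ψ n x * (I ^ (-(1 / r)) * ψ n x ^ (q - 1)) := by
                    rw [mul_left_comm]
                    congr 1
                    nth_rw 2 [← ENNReal.rpow_one (ψ n x)]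
                    rw [← ENNReal.rpow_add_of_nonneg _ _ (by norm_num) (by linarith)]
                    congr 1
                    ring
                _ ≤ _ := by
                    gcongr
                    exact hψle n x
      calc I = (I ^ (1 / q)) ^ q := by
            rw [← ENNReal.rpow_mul, one_div_mul_cancel hq0.ne', ENNReal.rpow_one]
        _ ≤ K ^ q := ENNReal.rpow_le_rpow h2 hq0.le
    · refine le_of_eq ?_
      calc ∫⁻ x, (I ^ (-(1 / r)) * ψ n x ^ (q - 1)) ^ r ∂μ
          = ∫⁻ x, I⁻¹ * ψ n x ^ q ∂μ := by
            refine lintegral_congr fun x => ?_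
            rw [ENNReal.mul_rpow_of_nonneg _ _ hr0.le, ← ENNReal.rpow_mul, ← ENNReal.rpow_mul,
              hqr.sub_one_mul_conj, neg_mul, one_div_mul_cancel hr0.ne', ENNReal.rpow_neg_one]
        _ = 1 := by
            rw [lintegral_const_mul _ ((hψm n).pow_const _), ENNReal.inv_mul_cancel h0 (hint n)]
  calc (∫⁻ x, φ x ^ q ∂μ) ^ (1 / q)
      = (∫⁻ x, ⨆ n, ψ n x ^ q ∂μ) ^ (1 / q) := by
        congr 1
        refine lintegral_congr fun x => ?_
        rw [← hψsup x]
        exact (ENNReal.orderIsoRpow q hq0).map_iSup _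
    _ = (⨆ n, ∫⁻ x, ψ n x ^ q ∂μ) ^ (1 / q) := by
        rw [lintegral_iSup (fun n => (hψm n).pow_const _)]
        exact fun m n hmn x => ENNReal.rpow_le_rpow (hψmono hmn x) hq0.le
    _ ≤ (K ^ q) ^ (1 / q) := ENNReal.rpow_le_rpow (iSup_le hbd) (by positivity)
    _ = K := by rw [← ENNReal.rpow_mul, mul_one_div_cancel hq0.ne', ENNReal.rpow_one]

theorem measurableSet_dcube {d : ℕ} (i : DIdx d) : MeasurableSet (dcube i) := by
  have : dcube i = ⋂ j, (fun x : Fin d → ℝ => x j) ⁻¹'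
      Set.Ico ((2 : ℝ) ^ i.1 * (i.2 j : ℝ)) ((2 : ℝ) ^ i.1 * ((i.2 j : ℝ) + 1)) := by
    ext x
    rw [Set.mem_iInter]
    rfl
  rw [this]
  exact MeasurableSet.iInter fun j => measurable_pi_apply j measurableSet_Ico

theorem dcube_subset_of_le {d : ℕ} {i j : DIdx d} (hij : i.1 ≤ j.1) {x : Fin d → ℝ}
    (hi : x ∈ dcube i) (hj : x ∈ dcube j) : dcube i ⊆ dcube j := by
  intro y hy k
  obtain ⟨h1, h2⟩ := hi k
  obtain ⟨h3, h4⟩ := hj k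
  obtain ⟨h5, h6⟩ := hy k
  obtain ⟨e, he⟩ := Int.eq_ofNat_of_zero_le (sub_nonneg.2 hij)
  have hpos : (0 : ℝ) < 2 ^ i.1 := by positivity
  have hpow : (2 : ℝ) ^ j.1 = 2 ^ i.1 * ((2 ^ e : ℤ) : ℝ) := by
    rw [show j.1 = i.1 + e by omega, zpow_add₀ (by norm_num)]
    push_cast
    rw [zpow_natCast]
  have hlow : 2 ^ e * j.2 k < i.2 k + 1 := by
    have : (2 : ℝ) ^ i.1 * (((2 ^ e * j.2 k : ℤ)) : ℝ) < 2 ^ i.1 * ((i.2 k + 1 : ℤ) : ℝ) := by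
      push_cast at hpow ⊢
      rw [hpow, mul_assoc] at h3
      exact h3.trans_lt h2
    exact_mod_cast lt_of_mul_lt_mul_left this hpos.le
  have hupp : i.2 k < 2 ^ e * (j.2 k + 1) := by
    have : (2 : ℝ) ^ i.1 * ((i.2 k : ℤ) : ℝ) < 2 ^ i.1 * ((2 ^ e * (j.2 k + 1) : ℤ) : ℝ) := by
      push_cast at hpow ⊢
      rw [hpow, mul_assoc] at h4
      exact h1.trans_lt h4
    exact_mod_cast lt_of_mul_lt_mul_left this hpos.le
  rw [Set.mem_Ico, hpow, mul_assoc, mul_assoc]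
  constructor
  · refine le_trans ?_ h5
    gcongr
    exact_mod_cast Int.lt_add_one_iff.1 hlow
  · refine h6.trans_le ?_
    gcongr
    exact_mod_cast Int.add_one_le_iff.2 hupp

theorem dcube_subset_or_subset {d : ℕ} (i j : DIdx d) (h : (dcube i ∩ dcube j).Nonempty) :
    dcube i ⊆ dcube j ∨ dcube j ⊆ dcube i := by
  obtain ⟨x, hi, hj⟩ := h
  rcases le_total i.1 j.1 with hij | hij
  · exact Or.inl (dcube_subset_of_le hij hi hj)
  · exact Or.inr (dcube_subset_of_le hij hj hi)

theorem sigmaFinite_wMeasure {d : ℕ} {ω : (Fin d → ℝ) → ℝ≥0∞}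
    (hω : ∀ i : DIdx d, wMeasure ω (dcube i) ≠ ⊤) : SigmaFinite (wMeasure ω) := by
  refine Measure.sigmaFinite_of_countable (S := Set.range (dcube (d := d)))
    (Set.countable_range _) ?_ ?_
  · rintro _ ⟨i, rfl⟩
    exact (hω i).lt_top
  · refine Set.eq_univ_of_forall fun x => Set.mem_sUnion.2
      ⟨_, ⟨(0, fun j => ⌊x j⌋), rfl⟩, fun j => ?_⟩
    simp [Int.floor_le, Int.lt_floor_add_one]

/-- The coefficient of `(∫_Q f) 1_Q` in `T_τ f`. -/
def dcoef {d : ℕ} (τ : DIdx d → ℝ≥0∞) (i : DIdx d) : ℝ≥0∞ :=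
  τ i / volume (dcube i)

theorem mul_lavg {d : ℕ} (τ : DIdx d → ℝ≥0∞) (i : DIdx d) (f : (Fin d → ℝ) → ℝ≥0∞) :
    τ i * lavg i f = dcoef τ i * ∫⁻ x in dcube i, f x := by
  rw [lavg, cavg, dcoef, ENNReal.div_eq_inv_mul, ENNReal.div_eq_inv_mul]
  ring

theorem Tdy_mul_eq {d : ℕ} (τ : DIdx d → ℝ≥0∞) {f σ : (Fin d → ℝ) → ℝ≥0∞} (hf : Measurable f)
    (hσ : Measurable σ) (x : Fin d → ℝ) :
    Tdy τ (fun y => f y * σ y) x = ∑' i : DIdx d, (dcube i).indicator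
      (fun _ => dcoef τ i * ∫⁻ y in dcube i, f y ∂(wMeasure σ)) x := by
  refine tsum_congr fun i => ?_
  rw [mul_lavg, wMeasure, setLIntegral_withDensity_eq_setLIntegral_mul _ hσ hf
    (measurableSet_dcube i)]
  simp only [Pi.mul_apply, mul_comm]

theorem measurable_Tdy {d : ℕ} (τ : DIdx d → ℝ≥0∞) (f : (Fin d → ℝ) → ℝ≥0∞) :
    Measurable (Tdy τ f) :=
  Measurable.tsum fun i => measurable_const.indicator (measurableSet_dcube i)

theorem lintegral_Tdy_mul {d : ℕ} (τ : DIdx d → ℝ≥0∞) {f g σ : (Fin d → ℝ) → ℝ≥0∞}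
    (hf : Measurable f) (hg : Measurable g) (hσ : Measurable σ) (μ : Measure (Fin d → ℝ)) :
    ∫⁻ x, Tdy τ (fun y => f y * σ y) x * g x ∂μ = ∑' i : DIdx d,
      dcoef τ i * (∫⁻ y in dcube i, f y ∂(wMeasure σ)) * ∫⁻ y in dcube i, g y ∂μ := by
  simp_rw [Tdy_mul_eq τ hf hσ, ← ENNReal.tsum_mul_right]
  refine (lintegral_tsum fun i => ((measurable_const.indicator
    (measurableSet_dcube i)).mul hg).aemeasurable).trans (tsum_congr fun i => ?_)
  simp only [Pi.mul_apply]
  rw [← lintegral_indicator (measurableSet_dcube i) g,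
    ← lintegral_const_mul _ (hg.indicator (measurableSet_dcube i))]
  refine lintegral_congr fun x => ?_
  by_cases hx : x ∈ dcube i <;> simp [hx]

theorem TdyOut_indicator {d : ℕ} (τ : DIdx d → ℝ≥0∞) (R : DIdx d) (σ : (Fin d → ℝ) → ℝ≥0∞)
    (x : Fin d → ℝ) :
    TdyOut τ R ((dcube R).indicator σ) x = wMeasure σ (dcube R) *
      ∑' i : {i : DIdx d // dcube R ⊆ dcube i}, (dcube i.1).indicator (fun _ => dcoef τ i.1) x := by
  rw [TdyOut, ← ENNReal.tsum_mul_left]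
  refine tsum_congr fun ⟨i, hi⟩ => ?_
  rw [mul_lavg, wMeasure, withDensity_apply _ (measurableSet_dcube R),
    lintegral_indicator (measurableSet_dcube R), Measure.restrict_restrict (measurableSet_dcube R),
    Set.inter_eq_left.2 hi]
  by_cases hx : x ∈ dcube i
  · simp [hx, mul_comm]
  · simp [hx]

theorem lintegral_dcoef_le_gloTestDual {d : ℕ} {p q : ℝ} (hq : 0 < q) (τ : DIdx d → ℝ≥0∞)
    (σ ω : (Fin d → ℝ) → ℝ≥0∞) {R : DIdx d} (h0 : wMeasure σ (dcube R) ≠ 0)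
    (ht : wMeasure σ (dcube R) ≠ ⊤) :
    ∫⁻ x, (∑' i : {i : DIdx d // dcube R ⊆ dcube i},
        (dcube i.1).indicator (fun _ => dcoef τ i.1) x) ^ q ∂(wMeasure ω) ≤
      (gloTestDual p q τ σ ω * wMeasure σ (dcube R) ^ (1 / p - 1)) ^ q := by
  set s := wMeasure σ (dcube R) with hs
  set S : (Fin d → ℝ) → ℝ≥0∞ := fun x => ∑' i : {i : DIdx d // dcube R ⊆ dcube i},
    (dcube i.1).indicator (fun _ => dcoef τ i.1) x with hS
  have hSm : Measurable S :=
    Measurable.tsum fun i => measurable_const.indicator (measurableSet_dcube i.1)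
  have h1 : s ^ (-(1 / p)) * (s * (∫⁻ x, S x ^ q ∂(wMeasure ω)) ^ (1 / q)) ≤
      gloTestDual p q τ σ ω := by
    refine le_trans (le_of_eq ?_) (le_iSup₂ (f := fun (R : DIdx d)
      (_ : wMeasure σ (dcube R) ≠ 0) => wMeasure σ (dcube R) ^ (-(1 / p)) *
      lpn q (wMeasure ω) (TdyOut τ R ((dcube R).indicator σ))) R h0)
    simp_rw [lpn, TdyOut_indicator, ENNReal.mul_rpow_of_nonneg _ _ hq.le]
    rw [lintegral_const_mul _ (hSm.pow_const q),
      ENNReal.mul_rpow_of_nonneg _ _ (by positivity : 0 ≤ 1 / q), ← ENNReal.rpow_mul,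
      mul_one_div_cancel hq.ne', ENNReal.rpow_one]
  have h2 : (∫⁻ x, S x ^ q ∂(wMeasure ω)) ^ (1 / q) ≤
      gloTestDual p q τ σ ω * s ^ (1 / p - 1) := by
    calc (∫⁻ x, S x ^ q ∂(wMeasure ω)) ^ (1 / q)
        = s ^ (-(1 / p)) * (s * (∫⁻ x, S x ^ q ∂(wMeasure ω)) ^ (1 / q)) * s ^ (1 / p - 1) := by
          have : s ^ (-(1 / p)) * s * s ^ (1 / p - 1) = 1 := by
            nth_rw 2 [← ENNReal.rpow_one s]
            rw [← ENNReal.rpow_add _ _ h0 ht, ← ENNReal.rpow_add _ _ h0 ht,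
              show -(1 / p) + 1 + (1 / p - 1) = 0 by ring, ENNReal.rpow_zero]
          rw [← mul_assoc, mul_right_comm, this, one_mul]
      _ ≤ _ := by gcongr
  calc ∫⁻ x, S x ^ q ∂(wMeasure ω) = ((∫⁻ x, S x ^ q ∂(wMeasure ω)) ^ (1 / q)) ^ q := by
        rw [← ENNReal.rpow_mul, one_div_mul_cancel hq.ne', ENNReal.rpow_one]
    _ ≤ _ := ENNReal.rpow_le_rpow h2 hq.le

theorem lpn_le_one_iff {d : ℕ} {p : ℝ} (hp : 0 < p) (μ : Measure (Fin d → ℝ))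
    (f : (Fin d → ℝ) → ℝ≥0∞) : lpn p μ f ≤ 1 ↔ ∫⁻ x, f x ^ p ∂μ ≤ 1 := by
  rw [lpn, one_div, ENNReal.rpow_inv_le_iff hp, ENNReal.one_rpow]

theorem gloTestDual_le_strongConst {d : ℕ} {p q : ℝ} (hp : 0 < p) (hq : 0 < q)
    (τ : DIdx d → ℝ≥0∞) (σ ω : (Fin d → ℝ) → ℝ≥0∞)
    (hσt : ∀ i : DIdx d, wMeasure σ (dcube i) ≠ ⊤) :
    gloTestDual p q τ σ ω ≤ strongConst p q τ σ ω := by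
  refine iSup₂_le fun R h0 => ?_
  have hs := hσt R
  set s := wMeasure σ (dcube R) with hsdef
  have hc : s ^ (-(1 / p)) ≠ ⊤ := ENNReal.rpow_ne_top_of_ne_zero h0 hs
  have hf1 : lpn p (wMeasure σ) ((dcube R).indicator fun _ => s ^ (-(1 / p))) ≤ 1 := by
    rw [lpn_le_one_iff hp]
    refine le_of_eq ?_
    calc ∫⁻ x, (dcube R).indicator (fun _ => s ^ (-(1 / p))) x ^ p ∂(wMeasure σ)
        = ∫⁻ x, (dcube R).indicator (fun _ => s⁻¹) x ∂(wMeasure σ) := by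
          refine lintegral_congr fun x => ?_
          by_cases hx : x ∈ dcube R
          · rw [Set.indicator_of_mem hx, Set.indicator_of_mem hx, ← ENNReal.rpow_mul, neg_mul,
              one_div_mul_cancel hp.ne', ENNReal.rpow_neg_one]
          · simp [hx, hp]
      _ = 1 := by
          rw [lintegral_indicator_const (measurableSet_dcube R), ENNReal.inv_mul_cancel h0 hs]
  refine le_trans ?_ (le_iSup₂_of_le _ (measurable_const.indicator (measurableSet_dcube R))
    (le_iSup_of_le hf1 le_rfl))
  rw [lpn, lpn]
  calc s ^ (-(1 / p)) * (∫⁻ x, TdyOut τ R ((dcube R).indicator σ) x ^ q ∂(wMeasure ω)) ^ (1 / q)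
      = (∫⁻ x, (s ^ (-(1 / p)) * TdyOut τ R ((dcube R).indicator σ) x) ^ q ∂(wMeasure ω)) ^
          (1 / q) := by
        simp_rw [ENNReal.mul_rpow_of_nonneg _ _ hq.le]
        rw [lintegral_const_mul' _ _ (ENNReal.rpow_ne_top_of_nonneg hq.le hc),
          ENNReal.mul_rpow_of_nonneg _ _ (by positivity : 0 ≤ 1 / q), ← ENNReal.rpow_mul (s ^ _),
          mul_one_div_cancel hq.ne', ENNReal.rpow_one]
    _ ≤ _ := by
        gcongr with x
        rw [TdyOut, ← ENNReal.tsum_mul_left, Tdy]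
        refine le_trans (le_of_eq ?_) (ENNReal.tsum_comp_le_tsum_of_injective
          (f := fun i : {i : DIdx d // dcube R ⊆ dcube i} => i.1) Subtype.val_injective _)
        refine tsum_congr fun i => ?_
        rw [mul_lavg, mul_lavg]
        have : ∀ y, (dcube R).indicator (fun _ => s ^ (-(1 / p))) y * σ y =
            s ^ (-(1 / p)) * (dcube R).indicator σ y := fun y => by
          by_cases hy : y ∈ dcube R <;> simp [hy]
        simp_rw [this]
        rw [lintegral_const_mul' _ _ hc]
        by_cases hx : x ∈ dcube i.1
        · rw [Set.indicator_of_mem hx, Set.indicator_of_mem hx, mul_left_comm]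
        · simp [hx]

theorem strongConst_dual_le {d : ℕ} {p q p' r : ℝ} (hpp : p.HolderConjugate p')
    (hqr : q.HolderConjugate r) (τ : DIdx d → ℝ≥0∞) {σ ω : (Fin d → ℝ) → ℝ≥0∞}
    (hσ : Measurable σ) (hω : Measurable ω) (hσt : ∀ i : DIdx d, wMeasure σ (dcube i) ≠ ⊤) :
    strongConst r p' τ ω σ ≤ strongConst p q τ σ ω := by
  have := sigmaFinite_wMeasure hσt
  refine iSup₂_le fun g hg => iSup_le fun hg1 => ?_
  refine lintegral_rpow_le_of_forall_pairing_le hpp.symm (measurable_Tdy _ _) fun f hf hf1 => ?_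
  calc ∫⁻ x, Tdy τ (fun y => g y * ω y) x * f x ∂(wMeasure σ)
      = ∫⁻ x, Tdy τ (fun y => f y * σ y) x * g x ∂(wMeasure ω) := by
        rw [lintegral_Tdy_mul τ hg hf hω, lintegral_Tdy_mul τ hf hg hσ]
        exact tsum_congr fun i => mul_right_comm _ _ _
    _ ≤ lpn q (wMeasure ω) (Tdy τ fun y => f y * σ y) * lpn r (wMeasure ω) g :=
        ENNReal.lintegral_mul_le_Lp_mul_Lq _ hqr (measurable_Tdy _ _).aemeasurable
          hg.aemeasurable
    _ ≤ strongConst p q τ σ ω * 1 := by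
        gcongr
        exact le_iSup₂_of_le f hf (le_iSup_of_le ((lpn_le_one_iff hpp.pos _ _).2 hf1) le_rfl)
    _ = _ := mul_one _

open scoped Classical in
theorem sum_image_dcube_le_tsum {d : ℕ} (τ : DIdx d → ℝ≥0∞) (F : Finset (DIdx d)) (R : DIdx d)
    (x : Fin d → ℝ) :
    ∑ P ∈ F.image dcube with dcube R ⊆ P,
        P.indicator (fun _ => ∑ i ∈ F with dcube i = P, dcoef τ i) x ≤
      ∑' i : {i : DIdx d // dcube R ⊆ dcube i},
        (dcube i.1).indicator (fun _ => dcoef τ i.1) x := by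
  calc ∑ P ∈ F.image dcube with dcube R ⊆ P,
        P.indicator (fun _ => ∑ i ∈ F with dcube i = P, dcoef τ i) x
      = ∑ P ∈ F.image dcube, ∑ i ∈ F with dcube i = P,
          {i : DIdx d | dcube R ⊆ dcube i}.indicator
            (fun i => (dcube i).indicator (fun _ => dcoef τ i) x) i := by
        rw [Finset.sum_filter]
        refine Finset.sum_congr rfl fun P _ => ?_
        by_cases hP : dcube R ⊆ P
        · rw [if_pos hP]
          by_cases hx : x ∈ P
          · rw [Set.indicator_of_mem hx]
            refine Finset.sum_congr rfl fun i hi => ?_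
            have e := (Finset.mem_filter.1 hi).2
            rw [Set.indicator_of_mem (by rw [Set.mem_ofPred_eq, e]; exact hP),
              Set.indicator_of_mem (by rwa [e])]
          · rw [Set.indicator_of_notMem hx]
            refine (Finset.sum_eq_zero fun i hi => ?_).symm
            have e := (Finset.mem_filter.1 hi).2
            rw [Set.indicator_apply_eq_zero]
            intro _
            rw [Set.indicator_of_notMem (by rwa [e])]
        · rw [if_neg hP]
          refine (Finset.sum_eq_zero fun i hi => ?_).symm
          have e := (Finset.mem_filter.1 hi).2
          rw [Set.indicator_of_notMem (by rwa [Set.mem_ofPred_eq, e])]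
    _ = ∑ i ∈ F, {i : DIdx d | dcube R ⊆ dcube i}.indicator
            (fun i => (dcube i).indicator (fun _ => dcoef τ i) x) i :=
        Finset.sum_fiberwise_of_maps_to (fun i hi => Finset.mem_image_of_mem _ hi) _
    _ ≤ _ := by
        refine (ENNReal.sum_le_tsum F).trans (le_of_eq ?_)
        exact (tsum_subtype {i : DIdx d | dcube R ⊆ dcube i}
          fun i => (dcube i).indicator (fun _ => dcoef τ i) x).symm

theorem exists_strongConst_le {d : ℕ} {p q : ℝ} (hp : 1 < p) (hpq : p < q) :
    ∃ C : ℝ≥0∞, C ≠ ⊤ ∧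
      ∀ (τ : DIdx d → ℝ≥0∞) (σ ω : (Fin d → ℝ) → ℝ≥0∞), Measurable σ →
        (∀ i : DIdx d, wMeasure σ (dcube i) ≠ ⊤) → (∀ i : DIdx d, wMeasure ω (dcube i) ≠ ⊤) →
        strongConst p q τ σ ω ≤ C * (gloTest p q τ σ ω + gloTestDual p q τ σ ω) := by
  have hpp : p.HolderConjugate (p / (p - 1)) := Real.HolderConjugate.conjExponent hp
  have hqr : q.HolderConjugate (q / (q - 1)) := Real.HolderConjugate.conjExponent (hp.trans hpq)
  obtain ⟨C, hC, hbil⟩ := exists_bilinear_le hp hpq hpp hqr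
  refine ⟨C, hC, fun τ σ ω hσ hσt hωt => ?_⟩
  have := sigmaFinite_wMeasure hωt
  refine iSup₂_le fun f hf => iSup_le fun hf1 => ?_
  rw [lpn_le_one_iff hpp.pos] at hf1
  refine lintegral_rpow_le_of_forall_pairing_le hqr (measurable_Tdy _ _) fun g hg hg1 => ?_
  rw [lintegral_Tdy_mul τ hf hg hσ, ENNReal.tsum_eq_iSup_sum]
  refine iSup_le fun F => ?_
  classical
  refine le_trans (le_of_eq ?_) (hbil (wMeasure σ) (wMeasure ω) (F.image dcube)
    (fun P => ∑ i ∈ F with dcube i = P, dcoef τ i) (gloTest p q τ σ ω) (gloTestDual p q τ σ ω)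
    f g hf hg hf1 hg1 ?_ ?_ ?_ ?_ ?_ ?_)
  · rw [← Finset.sum_fiberwise_of_maps_to (fun i hi => Finset.mem_image_of_mem dcube hi)]
    refine Finset.sum_congr rfl fun P _ => ?_
    rw [Finset.sum_mul, Finset.sum_mul]
    refine Finset.sum_congr rfl fun i hi => ?_
    rw [(Finset.mem_filter.1 hi).2]
  all_goals simp only [Finset.forall_mem_image]
  · exact fun i _ => measurableSet_dcube i
  · exact fun i _ => hσt i
  · exact fun i _ => hωt i
  · exact fun i _ j _ => dcube_subset_or_subset i j
  · intro R _ h0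
    refine le_trans (lintegral_mono fun x => ENNReal.rpow_le_rpow
      (sum_image_dcube_le_tsum τ F R x) hpp.symm.pos.le) ?_
    exact lintegral_dcoef_le_gloTestDual hpp.symm.pos τ ω σ h0 (hωt R)
  · intro R _ h0
    refine le_trans (lintegral_mono fun x => ENNReal.rpow_le_rpow
      (sum_image_dcube_le_tsum τ F R x) hqr.pos.le) ?_
    exact lintegral_dcoef_le_gloTestDual hqr.pos τ σ ω h0 (hσt R)

/-- **Strong-type characterization by global testing, `1 < p < q < ∞`.** -/
theorem stmt7 (d : ℕ) (p q : ℝ) (hp : 1 < p) (hpq : p < q) :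
    ∃ c C : ℝ≥0∞, 0 < c ∧ c < ⊤ ∧ 0 < C ∧ C < ⊤ ∧
      ∀ (τ : DIdx d → ℝ≥0∞) (σ ω : (Fin d → ℝ) → ℝ≥0∞),
        Measurable σ → Measurable ω →
        (∀ i : DIdx d, wMeasure σ (dcube i) ≠ ⊤) →
        (∀ i : DIdx d, wMeasure ω (dcube i) ≠ ⊤) →
        c * (gloTest p q τ σ ω + gloTestDual p q τ σ ω) ≤ strongConst p q τ σ ω ∧
          strongConst p q τ σ ω ≤ C * (gloTest p q τ σ ω + gloTestDual p q τ σ ω) := by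
  have hpp : p.HolderConjugate (p / (p - 1)) := Real.HolderConjugate.conjExponent hp
  have hqr : q.HolderConjugate (q / (q - 1)) := Real.HolderConjugate.conjExponent (hp.trans hpq)
  obtain ⟨C, hC, hup⟩ := exists_strongConst_le (d := d) hp hpq
  refine ⟨2⁻¹, C + 1, by simp, by simp, by simp, by finiteness,
    fun τ σ ω hσ hω hσt hωt => ⟨?_, ?_⟩⟩
  · have h1 : gloTest p q τ σ ω ≤ strongConst p q τ σ ω :=
      (gloTestDual_le_strongConst hqr.symm.pos hpp.symm.pos τ ω σ hωt).trans
        (strongConst_dual_le hpp hqr τ hσ hω hσt)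
    have h2 := gloTestDual_le_strongConst hpp.pos hqr.pos τ σ ω hσt
    calc 2⁻¹ * (gloTest p q τ σ ω + gloTestDual p q τ σ ω)
        ≤ 2⁻¹ * (strongConst p q τ σ ω + strongConst p q τ σ ω) := by gcongr
      _ = strongConst p q τ σ ω := by
        rw [← two_mul, ← mul_assoc, ENNReal.inv_mul_cancel (by norm_num) (by norm_num), one_mul]
  · refine (hup τ σ ω hσ hσt hωt).trans ?_
    gcongr
    exact le_self_add
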